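/- arXiv:1705.07392 — 5 statements merged into one kernel-verified Lean document; each statement's English description precedes it below -/
import Mathlib

section
/- Suppose the three Einstein equations R₀₀ = (8πG/c⁴)·𝔗₀₀, R₀₂ = (8πG/c⁴)·𝔗₀₂ and R₂₂ = (8πG/c⁴)·𝔗₂₂ hold on D. Then on D the following three reduced field equations hold: (EAa) ∂₁²F' + ∂₃²F' + (1/Π)(∂₁F'·∂₁Π + ∂₃F'·∂₃Π) + (e^{4F'}/(2Π²))·[(∂₁A')² + (∂₃A')²] = (4πG/c⁴)·e^{−2F'+2K'}·(c²ρ + 3P); (EAb) ∂₁((e^{4F'}/Π)·∂₁A') + ∂₃((e^{4F'}/Π)·∂₃A') = 0; (EAc) ∂₁²Π + ∂₃²Π = (16πG/c⁴)·e^{−2F'+2K'}·P·Π. -/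
open Real

/-- Partial derivative with respect to the first coordinate ϖ. -/
noncomputable def pd1 (f : ℝ × ℝ → ℝ) (x : ℝ × ℝ) : ℝ := fderiv ℝ f x (1, 0)

/-- Partial derivative with respect to the second coordinate z. -/
noncomputable def pd3 (f : ℝ × ℝ → ℝ) (x : ℝ × ℝ) : ℝ := fderiv ℝ f x (0, 1)

/-- f' = f − 2(Ω/c)k − (Ω²/c²)l. -/
noncomputable def fP (Ω c : ℝ) (f k l : ℝ × ℝ → ℝ) (x : ℝ × ℝ) : ℝ :=
  f x - 2 * (Ω / c) * k x - (Ω ^ 2 / c ^ 2) * l x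

/-- Π = √(f·l + k²). -/
noncomputable def PiF (f k l : ℝ × ℝ → ℝ) (x : ℝ × ℝ) : ℝ :=
  Real.sqrt (f x * l x + (k x) ^ 2)

/-- k' = k + (Ω/c)l. -/
noncomputable def kP (Ω c : ℝ) (k l : ℝ × ℝ → ℝ) (x : ℝ × ℝ) : ℝ :=
  k x + (Ω / c) * l x

/-- F' = ½ log f'. -/
noncomputable def FP (Ω c : ℝ) (f k l : ℝ × ℝ → ℝ) (x : ℝ × ℝ) : ℝ :=
  (1 / 2) * Real.log (fP Ω c f k l x)

/-- A' = −k'/f'. -/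
noncomputable def AP (Ω c : ℝ) (f k l : ℝ × ℝ → ℝ) (x : ℝ × ℝ) : ℝ :=
  -(kP Ω c k l x) / fP Ω c f k l x

/-- K' = F' + m/2. -/
noncomputable def KP (Ω c : ℝ) (f k l m : ℝ × ℝ → ℝ) (x : ℝ × ℝ) : ℝ :=
  FP Ω c f k l x + m x / 2

/-- Σ = ∂₁f·∂₁l + ∂₃f·∂₃l + (∂₁k)² + (∂₃k)². -/
noncomputable def SigF (f k l : ℝ × ℝ → ℝ) (x : ℝ × ℝ) : ℝ :=
  pd1 f x * pd1 l x + pd3 f x * pd3 l x + (pd1 k x) ^ 2 + (pd3 k x) ^ 2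

/-- Ricci component R₀₀ of the Lewis metric. -/
noncomputable def R00 (f k l m : ℝ × ℝ → ℝ) (x : ℝ × ℝ) : ℝ :=
  (PiF f k l x * Real.exp (-(m x)) / 2) *
    (pd1 (fun y => pd1 f y / PiF f k l y) x + pd3 (fun y => pd3 f y / PiF f k l y) x
      + f x * SigF f k l x / (PiF f k l x) ^ 3)

/-- Ricci component R₀₂ of the Lewis metric. -/
noncomputable def R02 (f k l m : ℝ × ℝ → ℝ) (x : ℝ × ℝ) : ℝ :=
  -((PiF f k l x * Real.exp (-(m x)) / 2) *
    (pd1 (fun y => pd1 k y / PiF f k l y) x + pd3 (fun y => pd3 k y / PiF f k l y) x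
      + k x * SigF f k l x / (PiF f k l x) ^ 3))

/-- Ricci component R₂₂ of the Lewis metric. -/
noncomputable def R22 (f k l m : ℝ × ℝ → ℝ) (x : ℝ × ℝ) : ℝ :=
  -((PiF f k l x * Real.exp (-(m x)) / 2) *
    (pd1 (fun y => pd1 l y / PiF f k l y) x + pd3 (fun y => pd3 l y / PiF f k l y) x
      + l x * SigF f k l x / (PiF f k l x) ^ 3))

/-- Ricci component R₁₁ of the Lewis metric. -/
noncomputable def R11 (f k l m : ℝ × ℝ → ℝ) (x : ℝ × ℝ) : ℝ :=
  (1 / 2) * (-(pd1 (pd1 m) x) - pd3 (pd3 m) x - 2 * pd1 (pd1 (PiF f k l)) x / PiF f k l x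
    + (1 / PiF f k l x) * (pd1 m x * pd1 (PiF f k l) x - pd3 m x * pd3 (PiF f k l) x)
    + (1 / (PiF f k l x) ^ 2) * (pd1 f x * pd1 l x + (pd1 k x) ^ 2))

/-- Ricci component R₃₃ of the Lewis metric. -/
noncomputable def R33 (f k l m : ℝ × ℝ → ℝ) (x : ℝ × ℝ) : ℝ :=
  (1 / 2) * (-(pd1 (pd1 m) x) - pd3 (pd3 m) x - 2 * pd3 (pd3 (PiF f k l)) x / PiF f k l x
    - (1 / PiF f k l x) * (pd1 m x * pd1 (PiF f k l) x - pd3 m x * pd3 (PiF f k l) x)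
    + (1 / (PiF f k l x) ^ 2) * (pd3 f x * pd3 l x + (pd3 k x) ^ 2))

/-- Ricci component R₁₃ of the Lewis metric. -/
noncomputable def R13 (f k l m : ℝ × ℝ → ℝ) (x : ℝ × ℝ) : ℝ :=
  (1 / 2) * (-(2 * pd1 (pd3 (PiF f k l)) x / PiF f k l x)
    + (1 / PiF f k l x) * (pd3 m x * pd1 (PiF f k l) x + pd1 m x * pd3 (PiF f k l) x)
    + (1 / (2 * (PiF f k l x) ^ 2)) *
        (pd1 f x * pd3 l x + pd1 l x * pd3 f x + 2 * pd1 k x * pd3 k x))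

/-- 𝔗₀₀ component of T_{μν} − ½ g_{μν} T. -/
noncomputable def T00 (Ω c : ℝ) (f k l ρ P : ℝ × ℝ → ℝ) (x : ℝ × ℝ) : ℝ :=
  (1 / 2) * (c ^ 2 * ρ x + P x) * (1 / fP Ω c f k l x) *
    ((f x - (Ω / c) * k x) ^ 2 + (Ω ^ 2 / c ^ 2) * (PiF f k l x) ^ 2) + P x * f x

/-- 𝔗₀₂ component of T_{μν} − ½ g_{μν} T. -/
noncomputable def T02 (Ω c : ℝ) (f k l ρ P : ℝ × ℝ → ℝ) (x : ℝ × ℝ) : ℝ :=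
  (1 / 2) * (c ^ 2 * ρ x + P x) * (1 / fP Ω c f k l x) *
    (-(k x * f x) - 2 * (Ω / c) * f x * l x + (Ω ^ 2 / c ^ 2) * k x * l x) - P x * k x

/-- 𝔗₂₂ component of T_{μν} − ½ g_{μν} T. -/
noncomputable def T22 (Ω c : ℝ) (f k l ρ P : ℝ × ℝ → ℝ) (x : ℝ × ℝ) : ℝ :=
  (1 / 2) * (c ^ 2 * ρ x + P x) * (1 / fP Ω c f k l x) *
    ((PiF f k l x) ^ 2 + (k x + (Ω / c) * l x) ^ 2) - P x * l x

/-- Equation (EAa) at a point. -/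
noncomputable def EAa (Ω c G : ℝ) (f k l m ρ P : ℝ × ℝ → ℝ) (x : ℝ × ℝ) : Prop :=
  pd1 (pd1 (FP Ω c f k l)) x + pd3 (pd3 (FP Ω c f k l)) x
    + (1 / PiF f k l x) * (pd1 (FP Ω c f k l) x * pd1 (PiF f k l) x
        + pd3 (FP Ω c f k l) x * pd3 (PiF f k l) x)
    + (Real.exp (4 * FP Ω c f k l x) / (2 * (PiF f k l x) ^ 2)) *
        ((pd1 (AP Ω c f k l) x) ^ 2 + (pd3 (AP Ω c f k l) x) ^ 2)
    = (4 * π * G / c ^ 4) * Real.exp (-2 * FP Ω c f k l x + 2 * KP Ω c f k l m x) *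
        (c ^ 2 * ρ x + 3 * P x)

/-- Equation (EAb) at a point. -/
noncomputable def EAb (Ω c : ℝ) (f k l : ℝ × ℝ → ℝ) (x : ℝ × ℝ) : Prop :=
  pd1 (fun y => (Real.exp (4 * FP Ω c f k l y) / PiF f k l y) * pd1 (AP Ω c f k l) y) x
    + pd3 (fun y => (Real.exp (4 * FP Ω c f k l y) / PiF f k l y) * pd3 (AP Ω c f k l) y) x
    = 0

/-- Equation (EAc) at a point. -/
noncomputable def EAc (Ω c G : ℝ) (f k l m P : ℝ × ℝ → ℝ) (x : ℝ × ℝ) : Prop :=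
  pd1 (pd1 (PiF f k l)) x + pd3 (pd3 (PiF f k l)) x
    = (16 * π * G / c ^ 4) * Real.exp (-2 * FP Ω c f k l x + 2 * KP Ω c f k l m x) *
        P x * PiF f k l x

/-- Equation (ECd) at a point. -/
noncomputable def ECd (Ω c : ℝ) (f k l m : ℝ × ℝ → ℝ) (x : ℝ × ℝ) : Prop :=
  pd1 (PiF f k l) x * pd1 (KP Ω c f k l m) x - pd3 (PiF f k l) x * pd3 (KP Ω c f k l m) x
    = (1 / 2) * (pd1 (pd1 (PiF f k l)) x - pd3 (pd3 (PiF f k l)) x)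
      + PiF f k l x * ((pd1 (FP Ω c f k l) x) ^ 2 - (pd3 (FP Ω c f k l) x) ^ 2)
      - (Real.exp (4 * FP Ω c f k l x) / (4 * PiF f k l x)) *
          ((pd1 (AP Ω c f k l) x) ^ 2 - (pd3 (AP Ω c f k l) x) ^ 2)

/-- Equation (ECe) at a point. -/
noncomputable def ECe (Ω c : ℝ) (f k l m : ℝ × ℝ → ℝ) (x : ℝ × ℝ) : Prop :=
  pd3 (PiF f k l) x * pd1 (KP Ω c f k l m) x + pd1 (PiF f k l) x * pd3 (KP Ω c f k l m) x
    = pd1 (pd3 (PiF f k l)) x + 2 * PiF f k l x * pd1 (FP Ω c f k l) x * pd3 (FP Ω c f k l) x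
      - (Real.exp (4 * FP Ω c f k l x) / (2 * PiF f k l x)) *
          pd1 (AP Ω c f k l) x * pd3 (AP Ω c f k l) x

/-- The Einstein equations in the corotating frame: `X`, `Y`, `Z` are the brackets in `R₀₀`,
`R₀₂`, `R₂₂`, and `r` stands for `c²ρ + P`. -/
theorem corotating_einstein {q M φ κ f k l ω N p r X Y Z : ℝ} (hφ : φ ≠ 0) (hM : M ≠ 0)
    (hq0 : q ≠ 0)
    (hφ_def : φ = f - 2 * ω * k - ω ^ 2 * l) (hκ_def : κ = k + ω * l)
    (hq : q ^ 2 = f * l + k ^ 2)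
    (h00 : q * M⁻¹ / 2 * X
      = N * (1 / 2 * r * (1 / φ) * ((f - ω * k) ^ 2 + ω ^ 2 * q ^ 2) + p * f))
    (h02 : -(q * M⁻¹ / 2 * Y)
      = N * (1 / 2 * r * (1 / φ) * (-(k * f) - 2 * ω * f * l + ω ^ 2 * k * l) - p * k))
    (h22 : -(q * M⁻¹ / 2 * Z) = N * (1 / 2 * r * (1 / φ) * (q ^ 2 + (k + ω * l) ^ 2) - p * l)) :
    q / (2 * φ) * (X - 2 * ω * Y - ω ^ 2 * Z) = N * M * (r + 2 * p) / 2 ∧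
      κ * (X - 2 * ω * Y - ω ^ 2 * Z) = φ * (Y + ω * Z) ∧
      φ * Z + l * (X - 2 * ω * Y - ω ^ 2 * Z) + 2 * κ * (Y + ω * Z) = 4 * N * M * p * q := by
  obtain rfl : f = φ + 2 * ω * k + ω ^ 2 * l := by linarith
  subst hκ_def
  have h1 : φ * (q * (X - 2 * ω * Y - ω ^ 2 * Z)) = φ * (N * M * φ * (r + 2 * p)) := by
    field_simp at h00 h02 h22
    linear_combination h00 + 2 * ω * h02 + ω ^ 2 * h22 + 2 * N * M * r * ω ^ 2 * hq
  have h2 : φ * (q * (Y + ω * Z)) = φ * (N * M * (k + ω * l) * (r + 2 * p)) := by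
    field_simp at h02 h22
    linear_combination -h02 - ω * h22 - N * M * r * ω * hq
  have h1 := mul_left_cancel₀ hφ h1
  have h2 := mul_left_cancel₀ hφ h2
  refine ⟨?_, mul_left_cancel₀ hq0 ?_, mul_left_cancel₀ hq0 ?_⟩
  · field_simp
    linear_combination h1
  · linear_combination (k + ω * l) * h1 - φ * h2
  field_simp at h22
  linear_combination -h22 + l * h1 + 2 * (k + ω * l) * h2 - N * M * (r + 4 * p) * hq

section DirectionalDerivative

variable {E : Type*} [NormedAddCommGroup E] [NormedSpace ℝ E] {D : Set E} {x : E}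

/-- The derivative of `g` at `x` in the direction `v`. -/
noncomputable def dirDeriv (v : E) (g : E → ℝ) (x : E) : ℝ := fderiv ℝ g x v

theorem pd1_eq_dirDeriv : pd1 = dirDeriv (1, 0) := rfl

theorem pd3_eq_dirDeriv : pd3 = dirDeriv (0, 1) := rfl

theorem dirDeriv_congr (hD : IsOpen D) (hx : x ∈ D) {g h : E → ℝ} (H : ∀ y ∈ D, g y = h y)
    (v : E) : dirDeriv v g x = dirDeriv v h x := by
  have : g =ᶠ[nhds x] h := Filter.eventuallyEq_of_mem (hD.mem_nhds hx) H
  rw [dirDeriv, dirDeriv, this.fderiv_eq]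

theorem ContDiffOn.dirDeriv {g : E → ℝ} (hg : ContDiffOn ℝ (⊤ : ℕ∞) g D) (hD : IsOpen D)
    (v : E) : ContDiffOn ℝ (⊤ : ℕ∞) (dirDeriv v g) D :=
  (hg.fderiv_of_isOpen hD (by simp)).clm_apply contDiffOn_const

theorem ContDiffOn.differentiableAt_of_isOpen {g : E → ℝ} (hg : ContDiffOn ℝ (⊤ : ℕ∞) g D)
    (hD : IsOpen D) (hx : x ∈ D) : DifferentiableAt ℝ g x :=
  (hg.contDiffAt (hD.mem_nhds hx)).differentiableAt (by simp)

variable {g h : E → ℝ}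

theorem dirDeriv_add (hg : DifferentiableAt ℝ g x) (hh : DifferentiableAt ℝ h x) (v : E) :
    dirDeriv v (fun y => g y + h y) x = dirDeriv v g x + dirDeriv v h x := by
  simp [dirDeriv, fderiv_fun_add hg hh]

theorem dirDeriv_const_mul (hg : DifferentiableAt ℝ g x) (a : ℝ) (v : E) :
    dirDeriv v (fun y => a * g y) x = a * dirDeriv v g x := by
  simp [dirDeriv, fderiv_const_mul hg]

theorem dirDeriv_mul (hg : DifferentiableAt ℝ g x) (hh : DifferentiableAt ℝ h x) (v : E) :
    dirDeriv v (fun y => g y * h y) x = dirDeriv v g x * h x + g x * dirDeriv v h x := by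
  simp only [dirDeriv, fderiv_fun_mul hg hh, add_apply,
    smul_apply, smul_eq_mul]
  ring

theorem dirDeriv_div (hg : DifferentiableAt ℝ g x) (hh : DifferentiableAt ℝ h x) (h0 : h x ≠ 0)
    (v : E) :
    dirDeriv v (fun y => g y / h y) x
      = (dirDeriv v g x * h x - g x * dirDeriv v h x) / h x ^ 2 := by
  have hq : DifferentiableAt ℝ (fun y => g y / h y) x := by
    simpa only [div_eq_mul_inv] using hg.fun_mul (hh.fun_inv h0)
  have hmul := dirDeriv_mul hq hh v
  have hev : (fun y => g y / h y * h y) =ᶠ[nhds x] g := by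
    filter_upwards [hh.continuousAt.eventually_ne h0] with y hy using div_mul_cancel₀ _ hy
  rw [dirDeriv, hev.fderiv_eq, ← dirDeriv] at hmul
  rw [hmul]
  field_simp
  ring

theorem dirDeriv_log (hg : DifferentiableAt ℝ g x) (h0 : g x ≠ 0) (v : E) :
    dirDeriv v (fun y => Real.log (g y)) x = dirDeriv v g x / g x := by
  simp only [dirDeriv, (hg.hasFDerivAt.log h0).fderiv, smul_apply,
    smul_eq_mul]
  ring

theorem ContDiffOn.differentiableAt_div (hD : IsOpen D) (hg : ContDiffOn ℝ (⊤ : ℕ∞) g D)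
    (hh : ContDiffOn ℝ (⊤ : ℕ∞) h D) (h0 : ∀ y ∈ D, h y ≠ 0) (hx : x ∈ D) :
    DifferentiableAt ℝ (fun y => g y / h y) x :=
  (hg.div hh h0).differentiableAt_of_isOpen hD hx

theorem dirDeriv_div_of_contDiffOn (hD : IsOpen D) (hg : ContDiffOn ℝ (⊤ : ℕ∞) g D)
    (hh : ContDiffOn ℝ (⊤ : ℕ∞) h D) (h0 : ∀ y ∈ D, h y ≠ 0) (hx : x ∈ D) (v : E) :
    dirDeriv v (fun y => g y / h y) x
      = (dirDeriv v g x * h x - g x * dirDeriv v h x) / h x ^ 2 :=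
  dirDeriv_div (hg.differentiableAt_of_isOpen hD hx) (hh.differentiableAt_of_isOpen hD hx)
    (h0 x hx) v

/-- Linear combinations pass through the operator `g ↦ ∂ᵥ(∂ᵥ g / Q)`. -/
theorem dirDeriv_dirDeriv_div_add_const_mul {Q : E → ℝ} (hD : IsOpen D)
    (hg : ContDiffOn ℝ (⊤ : ℕ∞) g D) (hh : ContDiffOn ℝ (⊤ : ℕ∞) h D)
    (hQ : ContDiffOn ℝ (⊤ : ℕ∞) Q D) (hQ0 : ∀ y ∈ D, Q y ≠ 0) (hx : x ∈ D) (a : ℝ) (v : E) :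
    dirDeriv v (fun y => dirDeriv v (fun z => g z + a * h z) y / Q y) x
      = dirDeriv v (fun y => dirDeriv v g y / Q y) x
        + a * dirDeriv v (fun y => dirDeriv v h y / Q y) x := by
  have hd {u : E → ℝ} (hu : ContDiffOn ℝ (⊤ : ℕ∞) u D) {y : E} (hy : y ∈ D) :=
    hu.differentiableAt_of_isOpen hD hy
  rw [dirDeriv_congr hD hx (h := fun y => dirDeriv v g y / Q y + a * (dirDeriv v h y / Q y))]
  · have hgQ := (hg.dirDeriv hD v).differentiableAt_div hD hQ hQ0 hx
    have hhQ := (hh.dirDeriv hD v).differentiableAt_div hD hQ hQ0 hx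
    rw [dirDeriv_add hgQ (hhQ.const_mul a), dirDeriv_const_mul hhQ]
  · intro y hy
    rw [dirDeriv_add (hd hg hy) ((hd hh hy).const_mul a), dirDeriv_const_mul (hd hh hy)]
    ring

section Lewis

variable {φ κ l Q : E → ℝ}

theorem two_mul_self_mul_dirDeriv (hD : IsOpen D) (hφ : ContDiffOn ℝ (⊤ : ℕ∞) φ D)
    (hκ : ContDiffOn ℝ (⊤ : ℕ∞) κ D) (hl : ContDiffOn ℝ (⊤ : ℕ∞) l D)
    (hQ : ContDiffOn ℝ (⊤ : ℕ∞) Q D) (hQ2 : ∀ y ∈ D, Q y * Q y = φ y * l y + κ y * κ y)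
    (hx : x ∈ D) (v : E) :
    2 * (Q x * dirDeriv v Q x)
      = dirDeriv v φ x * l x + φ x * dirDeriv v l x + 2 * (κ x * dirDeriv v κ x) := by
  have hd {u : E → ℝ} (hu : ContDiffOn ℝ (⊤ : ℕ∞) u D) :=
    hu.differentiableAt_of_isOpen hD hx
  have h := dirDeriv_congr hD hx hQ2 v
  rw [dirDeriv_mul (hd hQ) (hd hQ), dirDeriv_add (hd (hφ.mul hl)) (hd (hκ.mul hκ)),
    dirDeriv_mul (hd hφ) (hd hl), dirDeriv_mul (hd hκ) (hd hκ)] at h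
  linarith

theorem two_mul_self_mul_dirDeriv_dirDeriv (hD : IsOpen D) (hφ : ContDiffOn ℝ (⊤ : ℕ∞) φ D)
    (hκ : ContDiffOn ℝ (⊤ : ℕ∞) κ D) (hl : ContDiffOn ℝ (⊤ : ℕ∞) l D)
    (hQ : ContDiffOn ℝ (⊤ : ℕ∞) Q D) (hQ2 : ∀ y ∈ D, Q y * Q y = φ y * l y + κ y * κ y)
    (hx : x ∈ D) (v : E) :
    2 * (dirDeriv v Q x ^ 2 + Q x * dirDeriv v (dirDeriv v Q) x)
      = dirDeriv v (dirDeriv v φ) x * l x + 2 * (dirDeriv v φ x * dirDeriv v l x)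
        + φ x * dirDeriv v (dirDeriv v l) x
        + 2 * (dirDeriv v κ x ^ 2 + κ x * dirDeriv v (dirDeriv v κ) x) := by
  have hd {u : E → ℝ} (hu : ContDiffOn ℝ (⊤ : ℕ∞) u D) :=
    hu.differentiableAt_of_isOpen hD hx
  have h := dirDeriv_congr hD hx
    (fun y hy => two_mul_self_mul_dirDeriv hD hφ hκ hl hQ hQ2 hy v) v
  have hφ' := hφ.dirDeriv hD v
  have hκ' := hκ.dirDeriv hD v
  have hl' := hl.dirDeriv hD v
  have hQ' := hQ.dirDeriv hD v
  rw [dirDeriv_const_mul (hd (hQ.mul hQ')), dirDeriv_mul (hd hQ) (hd hQ'),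
    dirDeriv_add (hd ((hφ'.mul hl).add (hφ.mul hl'))) ((hd (hκ.mul hκ')).const_mul 2),
    dirDeriv_add (hd (hφ'.mul hl)) (hd (hφ.mul hl')),
    dirDeriv_mul (hd hφ') (hd hl), dirDeriv_mul (hd hφ) (hd hl'),
    dirDeriv_const_mul (hd (hκ.mul hκ')), dirDeriv_mul (hd hκ) (hd hκ')] at h
  linarith

theorem dirDeriv_half_log (hD : IsOpen D) (hφ : ContDiffOn ℝ (⊤ : ℕ∞) φ D)
    (hφ0 : ∀ y ∈ D, φ y ≠ 0) (hx : x ∈ D) (v : E) :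
    dirDeriv v (fun y => (1 / 2) * Real.log (φ y)) x = (1 / 2) * (dirDeriv v φ x / φ x) := by
  have hd := hφ.differentiableAt_of_isOpen hD hx
  rw [dirDeriv_const_mul (hd.log (hφ0 x hx)), dirDeriv_log hd (hφ0 x hx)]

theorem dirDeriv_dirDeriv_half_log (hD : IsOpen D) (hφ : ContDiffOn ℝ (⊤ : ℕ∞) φ D)
    (hφ0 : ∀ y ∈ D, φ y ≠ 0) (hx : x ∈ D) (v : E) :
    dirDeriv v (dirDeriv v (fun y => (1 / 2) * Real.log (φ y))) x
      = (1 / 2) * ((dirDeriv v (dirDeriv v φ) x * φ x - dirDeriv v φ x * dirDeriv v φ x)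
          / φ x ^ 2) := by
  have hφ' := hφ.dirDeriv hD v
  rw [dirDeriv_congr hD hx (fun y hy => dirDeriv_half_log hD hφ hφ0 hy v),
    dirDeriv_const_mul (hφ'.differentiableAt_div hD hφ hφ0 hx),
    dirDeriv_div_of_contDiffOn hD hφ' hφ hφ0 hx]

theorem dirDeriv_neg_div (hD : IsOpen D) (hφ : ContDiffOn ℝ (⊤ : ℕ∞) φ D)
    (hκ : ContDiffOn ℝ (⊤ : ℕ∞) κ D) (hφ0 : ∀ y ∈ D, φ y ≠ 0) (hx : x ∈ D) (v : E) :
    dirDeriv v (fun y => -κ y / φ y) x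
      = (κ x * dirDeriv v φ x - dirDeriv v κ x * φ x) / φ x ^ 2 := by
  rw [dirDeriv_div_of_contDiffOn hD hκ.neg hφ hφ0 hx]
  simp only [dirDeriv, fderiv_fun_neg, neg_apply]
  ring

theorem exp_four_mul_half_log {a : ℝ} (ha : 0 < a) :
    Real.exp (4 * ((1 / 2) * Real.log a)) = a ^ 2 := by
  rw [show 4 * ((1 / 2) * Real.log a) = Real.log a + Real.log a by ring, Real.exp_add,
    Real.exp_log ha, sq]

/-- The contribution of the direction `v` to the equation for `F'`. -/
theorem dirDeriv_half_log_equation (hD : IsOpen D) (hφ : ContDiffOn ℝ (⊤ : ℕ∞) φ D)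
    (hκ : ContDiffOn ℝ (⊤ : ℕ∞) κ D) (hl : ContDiffOn ℝ (⊤ : ℕ∞) l D)
    (hQ : ContDiffOn ℝ (⊤ : ℕ∞) Q D) (hQ2 : ∀ y ∈ D, Q y * Q y = φ y * l y + κ y * κ y)
    (hφ0 : ∀ y ∈ D, 0 < φ y) (hQ0 : ∀ y ∈ D, Q y ≠ 0) (hx : x ∈ D) (v : E) :
    dirDeriv v (dirDeriv v (fun y => (1 / 2) * Real.log (φ y))) x
      + (1 / Q x) * (dirDeriv v (fun y => (1 / 2) * Real.log (φ y)) x * dirDeriv v Q x)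
      + (Real.exp (4 * ((1 / 2) * Real.log (φ x))) / (2 * Q x ^ 2))
        * dirDeriv v (fun y => -κ y / φ y) x ^ 2
      = Q x / (2 * φ x) * (dirDeriv v (fun y => dirDeriv v φ y / Q y) x
          + φ x * (dirDeriv v φ x * dirDeriv v l x + dirDeriv v κ x ^ 2) / Q x ^ 3) := by
  have hφ0' : ∀ y ∈ D, φ y ≠ 0 := fun y hy => (hφ0 y hy).ne'
  have h1 := two_mul_self_mul_dirDeriv hD hφ hκ hl hQ hQ2 hx v
  rw [exp_four_mul_half_log (hφ0 x hx), dirDeriv_dirDeriv_half_log hD hφ hφ0' hx,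
    dirDeriv_half_log hD hφ hφ0' hx, dirDeriv_neg_div hD hφ hκ hφ0' hx,
    dirDeriv_div_of_contDiffOn hD (hφ.dirDeriv hD v) hQ hQ0 hx]
  have hφx := hφ0' x hx
  have hQx := hQ0 x hx
  have h2 := hQ2 x hx
  generalize dirDeriv v (dirDeriv v φ) x = φ₂
  generalize dirDeriv v φ x = φ₁ at *
  generalize dirDeriv v κ x = κ₁ at *
  generalize dirDeriv v l x = l₁ at *
  generalize dirDeriv v Q x = Q₁ at *
  generalize φ x = a at *
  generalize κ x = b at *
  generalize l x = e at *
  generalize Q x = q at *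
  field_simp
  linear_combination (φ₁ * a) * h1 - φ₁ ^ 2 * h2

/-- The contribution of the direction `v` to the equation for `A'`. -/
theorem dirDeriv_exp_mul_dirDeriv_neg_div (hD : IsOpen D) (hφ : ContDiffOn ℝ (⊤ : ℕ∞) φ D)
    (hκ : ContDiffOn ℝ (⊤ : ℕ∞) κ D) (hQ : ContDiffOn ℝ (⊤ : ℕ∞) Q D)
    (hφ0 : ∀ y ∈ D, 0 < φ y) (hQ0 : ∀ y ∈ D, Q y ≠ 0) (hx : x ∈ D) (v : E) :
    dirDeriv v (fun y => (Real.exp (4 * ((1 / 2) * Real.log (φ y))) / Q y)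
        * dirDeriv v (fun y => -κ y / φ y) y) x
      = κ x * dirDeriv v (fun y => dirDeriv v φ y / Q y) x
        - φ x * dirDeriv v (fun y => dirDeriv v κ y / Q y) x := by
  have hd {u : E → ℝ} (hu : ContDiffOn ℝ (⊤ : ℕ∞) u D) :=
    hu.differentiableAt_of_isOpen hD hx
  have hφ0' : ∀ y ∈ D, φ y ≠ 0 := fun y hy => (hφ0 y hy).ne'
  have hφQ := (hφ.dirDeriv hD v).differentiableAt_div hD hQ hQ0 hx
  have hκQ := (hκ.dirDeriv hD v).differentiableAt_div hD hQ hQ0 hx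
  rw [dirDeriv_congr hD hx (h := fun y => κ y * (dirDeriv v φ y / Q y)
    + (-1) * (φ y * (dirDeriv v κ y / Q y)))]
  · rw [dirDeriv_add ((hd hκ).fun_mul hφQ) (((hd hφ).fun_mul hκQ).const_mul (-1)),
      dirDeriv_const_mul ((hd hφ).fun_mul hκQ), dirDeriv_mul (hd hκ) hφQ,
      dirDeriv_mul (hd hφ) hκQ]
    ring
  · intro y hy
    have hφy := hφ0' y hy
    have hQy := hQ0 y hy
    rw [exp_four_mul_half_log (hφ0 y hy), dirDeriv_neg_div hD hφ hκ hφ0' hy]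
    field_simp
    ring

/-- The contribution of the direction `v` to the equation for `Π`. -/
theorem two_mul_dirDeriv_dirDeriv (hD : IsOpen D) (hφ : ContDiffOn ℝ (⊤ : ℕ∞) φ D)
    (hκ : ContDiffOn ℝ (⊤ : ℕ∞) κ D) (hl : ContDiffOn ℝ (⊤ : ℕ∞) l D)
    (hQ : ContDiffOn ℝ (⊤ : ℕ∞) Q D) (hQ2 : ∀ y ∈ D, Q y * Q y = φ y * l y + κ y * κ y)
    (hQ0 : ∀ y ∈ D, Q y ≠ 0) (hx : x ∈ D) (v : E) :
    2 * dirDeriv v (dirDeriv v Q) x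
      = φ x * dirDeriv v (fun y => dirDeriv v l y / Q y) x
        + l x * dirDeriv v (fun y => dirDeriv v φ y / Q y) x
        + 2 * (κ x * dirDeriv v (fun y => dirDeriv v κ y / Q y) x)
        + 2 * (dirDeriv v φ x * dirDeriv v l x + dirDeriv v κ x ^ 2) / Q x := by
  have h1 := two_mul_self_mul_dirDeriv hD hφ hκ hl hQ hQ2 hx v
  have h3 := two_mul_self_mul_dirDeriv_dirDeriv hD hφ hκ hl hQ hQ2 hx v
  have hQx := hQ0 x hx
  rw [dirDeriv_div_of_contDiffOn hD (hφ.dirDeriv hD v) hQ hQ0 hx,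
    dirDeriv_div_of_contDiffOn hD (hκ.dirDeriv hD v) hQ hQ0 hx,
    dirDeriv_div_of_contDiffOn hD (hl.dirDeriv hD v) hQ hQ0 hx]
  field_simp
  linear_combination Q x * h3 - dirDeriv v Q x * h1

end Lewis

end DirectionalDerivative

/-- Proposition A: the (00), (02), (22) Einstein equations imply the three
reduced field equations (EAa), (EAb), (EAc). -/
theorem einstein_imp_reduced_field_equations
    (D : Set (ℝ × ℝ)) (hD : IsOpen D) (hDconn : IsConnected D)
    (Ω c G : ℝ) (hc : 0 < c) (hG : 0 < G)
    (f k l m ρ P : ℝ × ℝ → ℝ)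
    (hf : ContDiffOn ℝ (⊤ : ℕ∞) f D) (hk : ContDiffOn ℝ (⊤ : ℕ∞) k D) (hl : ContDiffOn ℝ (⊤ : ℕ∞) l D)
    (hm : ContDiffOn ℝ (⊤ : ℕ∞) m D) (hρ : ContDiffOn ℝ (⊤ : ℕ∞) ρ D) (hP : ContDiffOn ℝ (⊤ : ℕ∞) P D)
    (hpos : ∀ x ∈ D, 0 < f x * l x + (k x) ^ 2)
    (hfP : ∀ x ∈ D, 0 < fP Ω c f k l x)
    (hE00 : ∀ x ∈ D, R00 f k l m x = (8 * π * G / c ^ 4) * T00 Ω c f k l ρ P x)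
    (hE02 : ∀ x ∈ D, R02 f k l m x = (8 * π * G / c ^ 4) * T02 Ω c f k l ρ P x)
    (hE22 : ∀ x ∈ D, R22 f k l m x = (8 * π * G / c ^ 4) * T22 Ω c f k l ρ P x) :
    ∀ x ∈ D, EAa Ω c G f k l m ρ P x ∧ EAb Ω c f k l x ∧ EAc Ω c G f k l m P x := by
  intro x hx
  have hfP_eq : fP Ω c f k l
      = fun y => (f y + -(2 * (Ω / c)) * k y) + -(Ω / c) ^ 2 * l y := by
    funext y
    simp only [fP]
    ring
  have hk' : ContDiffOn ℝ (⊤ : ℕ∞) (fun y => f y + -(2 * (Ω / c)) * k y) D :=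
    hf.add (contDiffOn_const.mul hk)
  have hφ : ContDiffOn ℝ (⊤ : ℕ∞) (fP Ω c f k l) D := by
    rw [hfP_eq]
    exact hk'.add (contDiffOn_const.mul hl)
  have hκ : ContDiffOn ℝ (⊤ : ℕ∞) (kP Ω c k l) D := hk.add (contDiffOn_const.mul hl)
  have hQ : ContDiffOn ℝ (⊤ : ℕ∞) (PiF f k l) D :=
    ((hf.mul hl).add (hk.pow 2)).sqrt fun y hy => (hpos y hy).ne'
  have hQpos : ∀ y ∈ D, 0 < PiF f k l y := fun y hy => Real.sqrt_pos.2 (hpos y hy)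
  have hQ0 : ∀ y ∈ D, PiF f k l y ≠ 0 := fun y hy => (hQpos y hy).ne'
  have hQ2 : ∀ y ∈ D, PiF f k l y * PiF f k l y
      = fP Ω c f k l y * l y + kP Ω c k l y * kP Ω c k l y := fun y hy => by
    rw [PiF, Real.mul_self_sqrt (hpos y hy).le, fP, kP]
    ring
  have hd {u : ℝ × ℝ → ℝ} (hu : ContDiffOn ℝ (⊤ : ℕ∞) u D) :=
    hu.differentiableAt_of_isOpen hD hx
  -- the frame change leaves `Σ` invariant and acts linearly on `g ↦ ∂ᵥ(∂ᵥ g / Π)`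
  have hSig (v : ℝ × ℝ) : dirDeriv v (fP Ω c f k l) x * dirDeriv v l x
      + dirDeriv v (kP Ω c k l) x ^ 2
      = dirDeriv v f x * dirDeriv v l x + dirDeriv v k x ^ 2 := by
    rw [hfP_eq, dirDeriv_add (hd hk') ((hd hl).const_mul _),
      dirDeriv_add (hd hf) ((hd hk).const_mul _), dirDeriv_const_mul (hd hk),
      dirDeriv_const_mul (hd hl),
      show kP Ω c k l = fun y => k y + (Ω / c) * l y from rfl,
      dirDeriv_add (hd hk) ((hd hl).const_mul _), dirDeriv_const_mul (hd hl)]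
    ring
  have hLφ (v : ℝ × ℝ) : dirDeriv v (fun y => dirDeriv v (fP Ω c f k l) y / PiF f k l y) x
      = dirDeriv v (fun y => dirDeriv v f y / PiF f k l y) x
        + -(2 * (Ω / c)) * dirDeriv v (fun y => dirDeriv v k y / PiF f k l y) x
        + -(Ω / c) ^ 2 * dirDeriv v (fun y => dirDeriv v l y / PiF f k l y) x := by
    rw [hfP_eq, dirDeriv_dirDeriv_div_add_const_mul hD hk' hl hQ hQ0 hx,
      dirDeriv_dirDeriv_div_add_const_mul hD hf hk hQ hQ0 hx]
  have hLκ (v : ℝ × ℝ) : dirDeriv v (fun y => dirDeriv v (kP Ω c k l) y / PiF f k l y) x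
      = dirDeriv v (fun y => dirDeriv v k y / PiF f k l y) x
        + (Ω / c) * dirDeriv v (fun y => dirDeriv v l y / PiF f k l y) x :=
    dirDeriv_dirDeriv_div_add_const_mul hD hk hl hQ hQ0 hx _ v
  have ha (v : ℝ × ℝ) : dirDeriv v (dirDeriv v (FP Ω c f k l)) x
      + (1 / PiF f k l x) * (dirDeriv v (FP Ω c f k l) x * dirDeriv v (PiF f k l) x)
      + (Real.exp (4 * FP Ω c f k l x) / (2 * PiF f k l x ^ 2)) * dirDeriv v (AP Ω c f k l) x ^ 2
      = _ :=
    dirDeriv_half_log_equation hD hφ hκ hl hQ hQ2 hfP hQ0 hx v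
  have hb (v : ℝ × ℝ) : dirDeriv v (fun y => (Real.exp (4 * FP Ω c f k l y) / PiF f k l y)
      * dirDeriv v (AP Ω c f k l) y) x = _ :=
    dirDeriv_exp_mul_dirDeriv_neg_div hD hφ hκ hQ hfP hQ0 hx v
  have hc' (v : ℝ × ℝ) := two_mul_dirDeriv_dirDeriv hD hφ hκ hl hQ hQ2 hQ0 hx v
  simp only [hSig, hLφ, hLκ] at ha hb hc'
  have ha1 := ha (1, 0)
  have ha3 := ha (0, 1)
  have hb1 := hb (1, 0)
  have hb3 := hb (0, 1)
  have hc1 := hc' (1, 0)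
  have hc3 := hc' (0, 1)
  have e00 := hE00 x hx
  have e02 := hE02 x hx
  have e22 := hE22 x hx
  have hexp : Real.exp (-2 * FP Ω c f k l x + 2 * KP Ω c f k l m x) = Real.exp (m x) := by
    rw [KP]
    ring_nf
  have hφx : fP Ω c f k l x ≠ 0 := (hfP x hx).ne'
  have hQx := hQ0 x hx
  have hM := (Real.exp_pos (m x)).ne'
  have hQ2x : PiF f k l x ^ 2 = f x * l x + k x ^ 2 := Real.sq_sqrt (hpos x hx).le
  have hφ_def : fP Ω c f k l x = f x - 2 * (Ω / c) * k x - (Ω / c) ^ 2 * l x := by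
    rw [fP, div_pow]
  have hκ_def : kP Ω c k l x = k x + (Ω / c) * l x := rfl
  simp only [R00, R02, R22, T00, T02, T22, SigF, Real.exp_neg, pd1_eq_dirDeriv,
    pd3_eq_dirDeriv, ← div_pow] at e00 e02 e22
  simp only [EAa, EAb, EAc, hexp, pd1_eq_dirDeriv, pd3_eq_dirDeriv]
  obtain ⟨hX, hY, hZ⟩ := corotating_einstein hφx hM hQx hφ_def hκ_def hQ2x e00 e02 e22
  have hQ3 : PiF f k l x ^ 2 / PiF f k l x ^ 3 = 1 / PiF f k l x := by field_simp
  set S1 := dirDeriv (1, 0) f x * dirDeriv (1, 0) l x + dirDeriv (1, 0) k x ^ 2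
  set S3 := dirDeriv (0, 1) f x * dirDeriv (0, 1) l x + dirDeriv (0, 1) k x ^ 2
  refine ⟨?_, ?_, ?_⟩
  · linear_combination ha1 + ha3 + hX + PiF f k l x / (2 * fP Ω c f k l x)
      * ((S1 + S3) / PiF f k l x ^ 3) * hφ_def
  · linear_combination hb1 + hb3 + hY - (S1 + S3) / PiF f k l x ^ 3
      * (fP Ω c f k l x * hκ_def - kP Ω c k l x * hφ_def)
  · linear_combination (hc1 + hc3 + hZ) / 2
      - (S1 + S3) / PiF f k l x ^ 3
        * (l x / 2 * hφ_def + (k x + Ω / c * l x) * hκ_def - hQ2x) - (S1 + S3) * hQ3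
end

section
/- Suppose that on D the Einstein equations R₁₁ = (8πG/c⁴)·𝔗₁₁ and R₃₃ = (8πG/c⁴)·𝔗₃₃ hold (where 𝔗₁₁ = 𝔗₃₃ = (e^m/2)(c²ρ − P)), and that R₁₃ = 0. Then on D the two first-order equations for K' hold: (ECd) ∂₁Π·∂₁K' − ∂₃Π·∂₃K' = ½(∂₁²Π − ∂₃²Π) + Π·[(∂₁F')² − (∂₃F')²] − (e^{4F'}/(4Π))·[(∂₁A')² − (∂₃A')²]; (ECe) ∂₃Π·∂₁K' + ∂₁Π·∂₃K' = ∂₁∂₃Π + 2Π·∂₁F'·∂₃F' − (e^{4F'}/(2Π))·∂₁A'·∂₃A'. -/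
open Real

/-- The polarized quadratic form `∂f·∂l + (∂k)²` of the Lewis metric, with derivatives taken
along `v` and `w`, expressed through `PiF`, `FP` and `AP`. -/
lemma lewis_bilinear_identity {Ω c : ℝ} {f k l : ℝ × ℝ → ℝ} {x : ℝ × ℝ}
    (hf : DifferentiableAt ℝ f x) (hk : DifferentiableAt ℝ k x) (hl : DifferentiableAt ℝ l x)
    (hpos : 0 < f x * l x + (k x) ^ 2) (hfP : 0 < fP Ω c f k l x) (v w : ℝ × ℝ) :
    fderiv ℝ f x v * fderiv ℝ l x w + fderiv ℝ l x v * fderiv ℝ f x w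
        + 2 * fderiv ℝ k x v * fderiv ℝ k x w
      = 4 * PiF f k l x * (fderiv ℝ (PiF f k l) x v * fderiv ℝ (FP Ω c f k l) x w
          + fderiv ℝ (PiF f k l) x w * fderiv ℝ (FP Ω c f k l) x v)
        - 8 * PiF f k l x ^ 2 * fderiv ℝ (FP Ω c f k l) x v * fderiv ℝ (FP Ω c f k l) x w
        + 2 * Real.exp (4 * FP Ω c f k l x) * fderiv ℝ (AP Ω c f k l) x v
          * fderiv ℝ (AP Ω c f k l) x w := by
  have hfPd : HasFDerivAt (fP Ω c f k l) (fderiv ℝ f x - (2 * (Ω / c)) • fderiv ℝ k x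
      - (Ω ^ 2 / c ^ 2) • fderiv ℝ l x) x :=
    (hf.hasFDerivAt.sub (hk.hasFDerivAt.const_mul _)).sub (hl.hasFDerivAt.const_mul _)
  have hkPd : HasFDerivAt (kP Ω c k l) (fderiv ℝ k x + (Ω / c) • fderiv ℝ l x) x :=
    hk.hasFDerivAt.add (hl.hasFDerivAt.const_mul _)
  have hFPd := (hfPd.log hfP.ne').const_mul (1 / 2)
  have hAPd := hkPd.neg.mul ((hasDerivAt_inv hfP.ne').comp_hasFDerivAt x hfPd)
  have hPid := ((hf.hasFDerivAt.mul hl.hasFDerivAt).add (hk.hasFDerivAt.pow 2)).sqrt hpos.ne'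
  have eF : fderiv ℝ (FP Ω c f k l) x = _ := hFPd.fderiv
  have eA : fderiv ℝ (AP Ω c f k l) x = _ := hAPd.fderiv
  have eP : fderiv ℝ (PiF f k l) x = _ := hPid.fderiv
  have hPi : 0 < PiF f k l x := Real.sqrt_pos.2 hpos
  have hsq : PiF f k l x ^ 2 = f x * l x + k x ^ 2 := Real.sq_sqrt hpos.le
  have hPiv (u : ℝ × ℝ) : PiF f k l x * fderiv ℝ (PiF f k l) x u
      = (f x * fderiv ℝ l x u + l x * fderiv ℝ f x u + 2 * k x * fderiv ℝ k x u) / 2 := by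
    have hs : √(f x * l x + k x ^ 2) ≠ 0 := hPi.ne'
    rw [eP]
    simp [PiF]
    field_simp
  have hexp : Real.exp (4 * FP Ω c f k l x) = fP Ω c f k l x ^ 2 := by
    rw [FP, show 4 * (1 / 2 * Real.log (fP Ω c f k l x))
      = Real.log (fP Ω c f k l x) + Real.log (fP Ω c f k l x) by ring, Real.exp_add,
      Real.exp_log hfP, sq]
  have hFv (u : ℝ × ℝ) : fderiv ℝ (FP Ω c f k l) x u = (fderiv ℝ f x u
      - 2 * (Ω / c) * fderiv ℝ k x u - Ω ^ 2 / c ^ 2 * fderiv ℝ l x u)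
        / (2 * fP Ω c f k l x) := by
    rw [eF]
    simp
    field_simp
  have hAv (u : ℝ × ℝ) : fderiv ℝ (AP Ω c f k l) x u =
      (kP Ω c k l x * (fderiv ℝ f x u - 2 * (Ω / c) * fderiv ℝ k x u
        - Ω ^ 2 / c ^ 2 * fderiv ℝ l x u)
        - (fderiv ℝ k x u + Ω / c * fderiv ℝ l x u) * fP Ω c f k l x)
          / fP Ω c f k l x ^ 2 := by
    rw [eA]
    simp
    field_simp
    ring
  rw [mul_add, mul_assoc 4, mul_assoc 4, ← mul_assoc (PiF f k l x), ← mul_assoc (PiF f k l x),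
    hPiv, hPiv, hsq, hexp, hFv, hFv, hAv, hAv]
  have hp : f x = fP Ω c f k l x + 2 * (Ω / c) * k x + Ω ^ 2 / c ^ 2 * l x := by
    rw [fP]; ring
  rw [hp, kP]
  generalize fP Ω c f k l x = p at *
  rw [← div_pow]
  generalize Ω / c = ω
  field_simp
  ring

/-- Proposition C: the (11) and (33) Einstein equations together with R₁₃ = 0
imply the two first-order equations (ECd), (ECe) for K'. -/
theorem einstein_imp_first_order_Kprime
    (D : Set (ℝ × ℝ)) (hD : IsOpen D) (hDconn : IsConnected D)
    (Ω c G : ℝ) (hc : 0 < c) (hG : 0 < G)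
    (f k l m ρ P : ℝ × ℝ → ℝ)
    (hf : ContDiffOn ℝ (⊤ : ℕ∞) f D) (hk : ContDiffOn ℝ (⊤ : ℕ∞) k D) (hl : ContDiffOn ℝ (⊤ : ℕ∞) l D)
    (hm : ContDiffOn ℝ (⊤ : ℕ∞) m D) (hρ : ContDiffOn ℝ (⊤ : ℕ∞) ρ D) (hP : ContDiffOn ℝ (⊤ : ℕ∞) P D)
    (hpos : ∀ x ∈ D, 0 < f x * l x + (k x) ^ 2)
    (hfP : ∀ x ∈ D, 0 < fP Ω c f k l x)
    (hE11 : ∀ x ∈ D, R11 f k l m x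
      = (8 * π * G / c ^ 4) * ((Real.exp (m x) / 2) * (c ^ 2 * ρ x - P x)))
    (hE33 : ∀ x ∈ D, R33 f k l m x
      = (8 * π * G / c ^ 4) * ((Real.exp (m x) / 2) * (c ^ 2 * ρ x - P x)))
    (hE13 : ∀ x ∈ D, R13 f k l m x = 0) :
    ∀ x ∈ D, ECd Ω c f k l m x ∧ ECe Ω c f k l m x := by
  intro x hx
  have hdiff {g : ℝ × ℝ → ℝ} (hg : ContDiffOn ℝ (⊤ : ℕ∞) g D) : DifferentiableAt ℝ g x :=
    (hg.contDiffAt (hD.mem_nhds hx)).differentiableAt (by simp)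
  have hfPd : DifferentiableAt ℝ (fP Ω c f k l) x :=
    ((hdiff hf).sub ((hdiff hk).const_mul _)).sub ((hdiff hl).const_mul _)
  have hFPd : DifferentiableAt ℝ (FP Ω c f k l) x :=
    (hfPd.log (hfP x hx).ne').const_mul _
  have hK (u : ℝ × ℝ) : fderiv ℝ (KP Ω c f k l m) x u
      = fderiv ℝ (FP Ω c f k l) x u + fderiv ℝ m x u / 2 := by
    have h : fderiv ℝ (KP Ω c f k l m) x = _ :=
      (hFPd.hasFDerivAt.add ((hdiff hm).hasFDerivAt.mul_const (2⁻¹ : ℝ))).fderiv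
    rw [h]
    simp
    ring
  have hK1 : pd1 (KP Ω c f k l m) x = pd1 (FP Ω c f k l) x + pd1 m x / 2 := hK _
  have hK3 : pd3 (KP Ω c f k l m) x = pd3 (FP Ω c f k l) x + pd3 m x / 2 := hK _
  have key := lewis_bilinear_identity (hdiff hf) (hdiff hk) (hdiff hl) (hpos x hx) (hfP x hx)
  have key11 := key (1, 0) (1, 0)
  have key33 := key (0, 1) (0, 1)
  have key13 := key (1, 0) (0, 1)
  simp only [← pd1.eq_1, ← pd3.eq_1] at key11 key33 key13
  have hPi : PiF f k l x ≠ 0 := (Real.sqrt_pos.2 (hpos x hx)).ne'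
  have hdiag := (hE11 x hx).trans (hE33 x hx).symm
  have hoff := hE13 x hx
  rw [R11, R33] at hdiag
  rw [R13] at hoff
  rw [ECd, ECe, hK1, hK3]
  generalize PiF f k l x = p at *
  constructor
  · field_simp at hdiag ⊢
    linear_combination 2 * hdiag - key11 + key33
  · field_simp at hoff ⊢
    linear_combination (hoff - key13) / 2
end

section
/- Assume that on D: (B2) (∂₁Π)² + (∂₃Π)² > 0; the Einstein equations R₀₀ = (8πG/c⁴)·𝔗₀₀, R₀₂ = (8πG/c⁴)·𝔗₀₂, R₂₂ = (8πG/c⁴)·𝔗₂₂ hold; the Euler relations ∂_jP + (c²ρ + P)·∂_jF' = 0 hold for j = 1, 3; and the two first-order equations hold: (ECd) ∂₁Π·∂₁K' − ∂₃Π·∂₃K' = ½(∂₁²Π − ∂₃²Π) + Π·[(∂₁F')² − (∂₃F')²] − (e^{4F'}/(4Π))·[(∂₁A')² − (∂₃A')²]; (ECe) ∂₃Π·∂₁K' + ∂₁Π·∂₃K' = ∂₁∂₃Π + 2Π·∂₁F'·∂₃F' − (e^{4F'}/(2Π))·∂₁A'·∂₃A'. Then on D the remaining Einstein equations hold: R₁₁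 = (8πG/c⁴)·(e^m/2)(c²ρ − P) and R₃₃ = (8πG/c⁴)·(e^m/2)(c²ρ − P). -/
open Real

open scoped ContDiff

/-- `u` is differentiable at `x` with derivative `d` in the direction `v`. -/
def HasPD (v : ℝ × ℝ) (u : ℝ × ℝ → ℝ) (d : ℝ) (x : ℝ × ℝ) : Prop :=
  DifferentiableAt ℝ u x ∧ fderiv ℝ u x v = d

namespace HasPD

variable {v x : ℝ × ℝ} {u w : ℝ × ℝ → ℝ} {d e : ℝ}

theorem const (a : ℝ) : HasPD v (fun _ => a) 0 x :=
  ⟨differentiableAt_const a, by simp⟩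

theorem add (hu : HasPD v u d x) (hw : HasPD v w e x) :
    HasPD v (fun y => u y + w y) (d + e) x :=
  ⟨hu.1.add hw.1, by rw [fderiv_fun_add hu.1 hw.1, ← hu.2, ← hw.2]; rfl⟩

theorem sub (hu : HasPD v u d x) (hw : HasPD v w e x) :
    HasPD v (fun y => u y - w y) (d - e) x :=
  ⟨hu.1.sub hw.1, by rw [fderiv_fun_sub hu.1 hw.1, ← hu.2, ← hw.2]; rfl⟩

theorem mul (hu : HasPD v u d x) (hw : HasPD v w e x) :
    HasPD v (fun y => u y * w y) (d * w x + u x * e) x :=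
  ⟨hu.1.mul hw.1, by
    rw [fderiv_fun_mul hu.1 hw.1, ← hu.2, ← hw.2]
    simp only [add_apply, smul_apply, smul_eq_mul]
    ring⟩

theorem comp {g : ℝ → ℝ} {g' : ℝ} (hg : HasDerivAt g g' (u x)) (hu : HasPD v u d x) :
    HasPD v (fun y => g (u y)) (g' * d) x := by
  have h := hg.comp_hasFDerivAt x hu.1.hasFDerivAt
  refine ⟨h.differentiableAt, ?_⟩
  change fderiv ℝ (g ∘ u) x v = _
  rw [h.fderiv, ← hu.2]
  rfl

theorem div (hu : HasPD v u d x) (hw : HasPD v w e x) (h0 : w x ≠ 0) :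
    HasPD v (fun y => u y / w y) (d / w x - u x * e / w x ^ 2) x := by
  have h := hu.mul (comp (hasDerivAt_inv h0) hw)
  simp only [← div_eq_mul_inv] at h
  convert h using 1
  field_simp
  ring

theorem congr_deriv (hu : HasPD v u d x) (h : d = e) : HasPD v u e x := h ▸ hu

theorem eq_of_eqOn {D : Set (ℝ × ℝ)} (hD : IsOpen D) (hx : x ∈ D) (huw : Set.EqOn u w D)
    (hu : HasPD v u d x) (hw : HasPD v w e x) : d = e := by
  rw [← hu.2, ← hw.2, (huw.eventuallyEq_of_mem (hD.mem_nhds hx)).fderiv_eq]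

end HasPD

section PartialDerivatives

variable {D : Set (ℝ × ℝ)} {u : ℝ × ℝ → ℝ} {x : ℝ × ℝ}

theorem ContDiffOn.hasPD (hu : ContDiffOn ℝ ∞ u D) (hD : IsOpen D) (hx : x ∈ D) (v : ℝ × ℝ) :
    HasPD v u (fderiv ℝ u x v) x :=
  ⟨(hu.contDiffAt (hD.mem_nhds hx)).differentiableAt (by simp), rfl⟩

theorem ContDiffOn.hasPD1 (hu : ContDiffOn ℝ ∞ u D) (hD : IsOpen D) (hx : x ∈ D) :
    HasPD (1, 0) u (pd1 u x) x := hu.hasPD hD hx _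

theorem ContDiffOn.hasPD3 (hu : ContDiffOn ℝ ∞ u D) (hD : IsOpen D) (hx : x ∈ D) :
    HasPD (0, 1) u (pd3 u x) x := hu.hasPD hD hx _

theorem ContDiffOn.fderiv_apply_const (hu : ContDiffOn ℝ ∞ u D) (hD : IsOpen D) (v : ℝ × ℝ) :
    ContDiffOn ℝ ∞ (fun y => fderiv ℝ u y v) D :=
  (hu.fderiv_of_isOpen hD (by simp)).clm_apply contDiffOn_const

theorem ContDiffOn.pd1 (hu : ContDiffOn ℝ ∞ u D) (hD : IsOpen D) :
    ContDiffOn ℝ ∞ (pd1 u) D := hu.fderiv_apply_const hD _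

theorem ContDiffOn.pd3 (hu : ContDiffOn ℝ ∞ u D) (hD : IsOpen D) :
    ContDiffOn ℝ ∞ (pd3 u) D := hu.fderiv_apply_const hD _

theorem pd3_pd1_eq_pd1_pd3 (hu : ContDiffOn ℝ ∞ u D) (hD : IsOpen D) (hx : x ∈ D) :
    pd3 (pd1 u) x = pd1 (pd3 u) x := by
  have hc := hu.contDiffAt (hD.mem_nhds hx)
  have hd : DifferentiableAt ℝ (fderiv ℝ u) x :=
    (hc.fderiv_right (m := 1) (by norm_cast)).differentiableAt (by simp)
  have hs := (hc.isSymmSndFDerivAt (by simp; norm_cast)).eq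
  have key (v w : ℝ × ℝ) :
      fderiv ℝ (fun y => fderiv ℝ u y v) x w = fderiv ℝ (fderiv ℝ u) x w v := by
    rw [fderiv_clm_apply hd (differentiableAt_const v)]
    simp
  change fderiv ℝ (fun y => fderiv ℝ u y (1, 0)) x (0, 1) =
    fderiv ℝ (fun y => fderiv ℝ u y (0, 1)) x (1, 0)
  rw [key, key, hs]

end PartialDerivatives

/-- The integrability condition obtained by differentiating the two first-order equations for `K`:
it determines the Laplacian of `K`. -/
theorem laplacian_of_first_order {D : Set (ℝ × ℝ)} (hD : IsOpen D) {p F A K φ E ρ P : ℝ × ℝ → ℝ}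
    {κ : ℝ}
    (hp : ContDiffOn ℝ ∞ p D) (hF : ContDiffOn ℝ ∞ F D) (hA : ContDiffOn ℝ ∞ A D)
    (hK : ContDiffOn ℝ ∞ K D) (hP : ContDiffOn ℝ ∞ P D)
    (hφ : ∀ x ∈ D, ∀ v, HasPD v φ (2 * φ x * fderiv ℝ F x v) x)
    (hE : ∀ x ∈ D, ∀ v, HasPD v E (E x * (2 * fderiv ℝ K x v - 2 * fderiv ℝ F x v)) x)
    (hB2 : ∀ x ∈ D, 0 < pd1 p x ^ 2 + pd3 p x ^ 2)
    (hEuler1 : ∀ x ∈ D, pd1 P x + ρ x * pd1 F x = 0)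
    (hEuler3 : ∀ x ∈ D, pd3 P x + ρ x * pd3 F x = 0)
    (hFeq : ∀ x ∈ D, 2 * p x ^ 2 * (pd1 (pd1 F) x + pd3 (pd3 F) x)
      + 2 * p x * (pd1 F x * pd1 p x + pd3 F x * pd3 p x)
      + φ x ^ 2 * (pd1 A x ^ 2 + pd3 A x ^ 2) = κ * p x ^ 2 * E x * (ρ x + 2 * P x))
    (hAeq : ∀ x ∈ D, p x * (pd1 (pd1 A) x + pd3 (pd3 A) x)
      + 4 * p x * (pd1 A x * pd1 F x + pd3 A x * pd3 F x)
      - (pd1 A x * pd1 p x + pd3 A x * pd3 p x) = 0)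
    (hpeq : ∀ x ∈ D, pd1 (pd1 p) x + pd3 (pd3 p) x = 2 * κ * (E x * (P x * p x)))
    (hd : ∀ x ∈ D, 4 * (p x * (pd1 p x * pd1 K x - pd3 p x * pd3 K x)) =
      2 * (p x * (pd1 (pd1 p) x - pd3 (pd3 p) x))
      + 4 * ((p x * p x) * (pd1 F x * pd1 F x - pd3 F x * pd3 F x))
      - (φ x * φ x) * (pd1 A x * pd1 A x - pd3 A x * pd3 A x))
    (he : ∀ x ∈ D, 2 * (p x * (pd3 p x * pd1 K x + pd1 p x * pd3 K x)) =
      2 * (p x * pd1 (pd3 p) x) + 4 * ((p x * p x) * (pd1 F x * pd3 F x))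
      - (φ x * φ x) * (pd1 A x * pd3 A x)) :
    ∀ x ∈ D, 4 * p x ^ 2 * (pd1 (pd1 K) x + pd3 (pd3 K) x) =
      4 * κ * p x ^ 2 * E x * P x - φ x ^ 2 * (pd1 A x ^ 2 + pd3 A x ^ 2)
        - 4 * p x ^ 2 * (pd1 F x ^ 2 + pd3 F x ^ 2) := by
  intro x hx
  have cd (v : ℝ × ℝ) :=
    HasPD.eq_of_eqOn hD hx hd
      (.mul (.const 4) (.mul (hp.hasPD hD hx v)
        (.sub (.mul ((hp.pd1 hD).hasPD hD hx v) ((hK.pd1 hD).hasPD hD hx v))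
          (.mul ((hp.pd3 hD).hasPD hD hx v) ((hK.pd3 hD).hasPD hD hx v)))))
      (.sub (.add
        (.mul (.const 2) (.mul (hp.hasPD hD hx v)
          (.sub (((hp.pd1 hD).pd1 hD).hasPD hD hx v) (((hp.pd3 hD).pd3 hD).hasPD hD hx v))))
        (.mul (.const 4) (.mul (.mul (hp.hasPD hD hx v) (hp.hasPD hD hx v))
          (.sub (.mul ((hF.pd1 hD).hasPD hD hx v) ((hF.pd1 hD).hasPD hD hx v))
            (.mul ((hF.pd3 hD).hasPD hD hx v) ((hF.pd3 hD).hasPD hD hx v))))))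
        (.mul (.mul (hφ x hx v) (hφ x hx v))
          (.sub (.mul ((hA.pd1 hD).hasPD hD hx v) ((hA.pd1 hD).hasPD hD hx v))
            (.mul ((hA.pd3 hD).hasPD hD hx v) ((hA.pd3 hD).hasPD hD hx v)))))
  have ce (v : ℝ × ℝ) :=
    HasPD.eq_of_eqOn hD hx he
      (.mul (.const 2) (.mul (hp.hasPD hD hx v)
        (.add (.mul ((hp.pd3 hD).hasPD hD hx v) ((hK.pd1 hD).hasPD hD hx v))
          (.mul ((hp.pd1 hD).hasPD hD hx v) ((hK.pd3 hD).hasPD hD hx v)))))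
      (.sub (.add
        (.mul (.const 2) (.mul (hp.hasPD hD hx v) (((hp.pd3 hD).pd1 hD).hasPD hD hx v)))
        (.mul (.const 4) (.mul (.mul (hp.hasPD hD hx v) (hp.hasPD hD hx v))
          (.mul ((hF.pd1 hD).hasPD hD hx v) ((hF.pd3 hD).hasPD hD hx v)))))
        (.mul (.mul (hφ x hx v) (hφ x hx v))
          (.mul ((hA.pd1 hD).hasPD hD hx v) ((hA.pd3 hD).hasPD hD hx v))))
  have cp (v : ℝ × ℝ) :=
    HasPD.eq_of_eqOn hD hx hpeq
      (.add (((hp.pd1 hD).pd1 hD).hasPD hD hx v) (((hp.pd3 hD).pd3 hD).hasPD hD hx v))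
      (.mul (.const (2 * κ)) (.mul (hE x hx v) (.mul (hP.hasPD hD hx v) (hp.hasPD hD hx v))))
  have fold1 (u : ℝ × ℝ → ℝ) : fderiv ℝ u x (1, 0) = pd1 u x := rfl
  have fold3 (u : ℝ × ℝ → ℝ) : fderiv ℝ u x (0, 1) = pd3 u x := rfl
  have cd1 := cd (1, 0)
  have cd3 := cd (0, 1)
  have ce1 := ce (1, 0)
  have ce3 := ce (0, 1)
  have cp1 := cp (1, 0)
  have cp3 := cp (0, 1)
  have comm {u : ℝ × ℝ → ℝ} (hu : ContDiffOn ℝ ∞ u D) := pd3_pd1_eq_pd1_pd3 hu hD hx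
  have p133 := comm (hp.pd3 hD)
  have p113 : pd1 (pd1 (pd3 p)) x = pd3 (pd1 (pd1 p)) x := by
    rw [comm (hp.pd1 hD)]
    exact HasPD.eq_of_eqOn hD hx (fun y hy => (pd3_pd1_eq_pd1_pd3 hp hD hy).symm)
      (((hp.pd3 hD).pd1 hD).hasPD1 hD hx) (((hp.pd1 hD).pd3 hD).hasPD1 hD hx)
  simp only [fold1, fold3, comm hp, comm hF, comm hA, comm hK, p133, p113]
    at cd1 cd3 ce1 ce3 cp1 cp3
  have key1 : pd1 p x * (4 * p x ^ 2 * (pd1 (pd1 K) x + pd3 (pd3 K) x) -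
      (4 * κ * p x ^ 2 * E x * P x - φ x ^ 2 * (pd1 A x ^ 2 + pd3 A x ^ 2)
        - 4 * p x ^ 2 * (pd1 F x ^ 2 + pd3 F x ^ 2))) = 0 := by
    linear_combination p x * cd1 + 2 * p x * ce3 - pd1 p x * hd x hx - 2 * pd3 p x * he x hx
      + 2 * p x ^ 2 * cp1 - 4 * p x ^ 2 * pd1 K x * hpeq x hx + 4 * p x * pd1 F x * hFeq x hx
      - 2 * φ x ^ 2 * pd1 A x * hAeq x hx + 4 * κ * p x ^ 3 * E x * hEuler1 x hx
  have key3 : pd3 p x * (4 * p x ^ 2 * (pd1 (pd1 K) x + pd3 (pd3 K) x) -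
      (4 * κ * p x ^ 2 * E x * P x - φ x ^ 2 * (pd1 A x ^ 2 + pd3 A x ^ 2)
        - 4 * p x ^ 2 * (pd1 F x ^ 2 + pd3 F x ^ 2))) = 0 := by
    linear_combination 2 * p x * ce1 - p x * cd3 + pd3 p x * hd x hx - 2 * pd1 p x * he x hx
      + 2 * p x ^ 2 * cp3 - 4 * p x ^ 2 * pd3 K x * hpeq x hx + 4 * p x * pd3 F x * hFeq x hx
      - 2 * φ x ^ 2 * pd3 A x * hAeq x hx + 4 * κ * p x ^ 3 * E x * hEuler3 x hx
  have hne := (hB2 x hx).ne'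
  have h0 : (pd1 p x ^ 2 + pd3 p x ^ 2) * (4 * p x ^ 2 * (pd1 (pd1 K) x + pd3 (pd3 K) x) -
      (4 * κ * p x ^ 2 * E x * P x - φ x ^ 2 * (pd1 A x ^ 2 + pd3 A x ^ 2)
        - 4 * p x ^ 2 * (pd1 F x ^ 2 + pd3 F x ^ 2))) = 0 := by
    linear_combination pd1 p x * key1 + pd3 p x * key3
  exact sub_eq_zero.mp ((mul_eq_zero.mp h0).resolve_left hne)

/-- `p³` times the bracket occurring in the Ricci components `R₀₀`, `R₀₂`, `R₂₂`. -/
noncomputable def ricciBracket (p : ℝ × ℝ → ℝ) (s : ℝ) (u : ℝ × ℝ → ℝ) (x : ℝ × ℝ) : ℝ :=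
  p x ^ 2 * (pd1 (pd1 u) x + pd3 (pd3 u) x) - p x * (pd1 u x * pd1 p x + pd3 u x * pd3 p x)
    + u x * s

section Bracket

variable {D : Set (ℝ × ℝ)} {x : ℝ × ℝ} {p : ℝ × ℝ → ℝ}

theorem bracket_eq_ricciBracket_div (hD : IsOpen D) (hx : x ∈ D) (hp : ContDiffOn ℝ ∞ p D)
    (h0 : p x ≠ 0) (s : ℝ) {u : ℝ × ℝ → ℝ} (hu : ContDiffOn ℝ ∞ u D) :
    pd1 (fun y => pd1 u y / p y) x + pd3 (fun y => pd3 u y / p y) x + u x * s / p x ^ 3 =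
      ricciBracket p s u x / p x ^ 3 := by
  have h1 : pd1 (fun y => pd1 u y / p y) x = _ :=
    (((hu.pd1 hD).hasPD1 hD hx).div (hp.hasPD1 hD hx) h0).2
  have h3 : pd3 (fun y => pd3 u y / p y) x = _ :=
    (((hu.pd3 hD).hasPD3 hD hx).div (hp.hasPD3 hD hx) h0).2
  rw [h1, h3, ricciBracket]
  field_simp
  ring

theorem ricciBracket_of_component {e m s T κ r : ℝ} {u : ℝ × ℝ → ℝ} (h0 : p x ≠ 0)
    (he : e = Real.exp m)
    (h : p x * Real.exp (-m) / 2 * (ricciBracket p s u x / p x ^ 3) = r) (hr : r = κ * T) :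
    ricciBracket p s u x = 2 * κ * p x ^ 2 * e * T := by
  rw [hr, Real.exp_neg, ← he] at h
  have : e ≠ 0 := he ▸ (Real.exp_pos m).ne'
  field_simp at h
  linear_combination h

theorem ricciBracket_add_const_mul (hD : IsOpen D) (hx : x ∈ D) (s a : ℝ)
    {u v w : ℝ × ℝ → ℝ} (hu : ContDiffOn ℝ ∞ u D) (hv : ContDiffOn ℝ ∞ v D)
    (hw : ContDiffOn ℝ ∞ w D) (h : ∀ y ∈ D, w y = u y + a * v y) :
    ricciBracket p s w x = ricciBracket p s u x + a * ricciBracket p s v x := by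
  have h1 (y) (hy : y ∈ D) (d : ℝ × ℝ) :
      fderiv ℝ w y d = fderiv ℝ u y d + a * fderiv ℝ v y d := by
    have := HasPD.eq_of_eqOn hD hy h (hw.hasPD hD hy d)
      (.add (hu.hasPD hD hy d) (.mul (.const a) (hv.hasPD hD hy d)))
    linear_combination this
  have h2 (d : ℝ × ℝ) : fderiv ℝ (fun y => fderiv ℝ w y d) x d =
      fderiv ℝ (fun y => fderiv ℝ u y d) x d + a * fderiv ℝ (fun y => fderiv ℝ v y d) x d := by
    have := HasPD.eq_of_eqOn hD hx (fun y hy => h1 y hy d)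
      ((hw.fderiv_apply_const hD d).hasPD hD hx d)
      (.add ((hu.fderiv_apply_const hD d).hasPD hD hx d)
        (.mul (.const a) ((hv.fderiv_apply_const hD d).hasPD hD hx d)))
    linear_combination this
  have e1 : pd1 w x = pd1 u x + a * pd1 v x := h1 x hx _
  have e3 : pd3 w x = pd3 u x + a * pd3 v x := h1 x hx _
  have e11 : pd1 (pd1 w) x = pd1 (pd1 u) x + a * pd1 (pd1 v) x := h2 _
  have e33 : pd3 (pd3 w) x = pd3 (pd3 u) x + a * pd3 (pd3 v) x := h2 _
  rw [ricciBracket, ricciBracket, ricciBracket, e1, e3, e11, e33, h x hx]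
  ring

end Bracket

section Potentials

variable {D : Set (ℝ × ℝ)} {φ q l p F A : ℝ × ℝ → ℝ} {x : ℝ × ℝ}

theorem fderiv_twist (hD : IsOpen D) (hq : ContDiffOn ℝ ∞ q D) (hA : ContDiffOn ℝ ∞ A D)
    (hφ : ∀ x ∈ D, ∀ v, HasPD v φ (2 * φ x * fderiv ℝ F x v) x)
    (hqA : ∀ x ∈ D, q x = 0 - A x * φ x) (hx : x ∈ D) (v : ℝ × ℝ) :
    fderiv ℝ q x v = 0 - φ x * (fderiv ℝ A x v + 2 * (A x * fderiv ℝ F x v)) := by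
  have := HasPD.eq_of_eqOn hD hx hqA (hq.hasPD hD hx v)
    (.sub (.const 0) (.mul (hA.hasPD hD hx v) (hφ x hx v)))
  linear_combination this

theorem fderiv_det (hD : IsOpen D) (hq : ContDiffOn ℝ ∞ q D) (hl : ContDiffOn ℝ ∞ l D)
    (hp : ContDiffOn ℝ ∞ p D)
    (hφ : ∀ x ∈ D, ∀ v, HasPD v φ (2 * φ x * fderiv ℝ F x v) x)
    (hdet : ∀ x ∈ D, p x * p x = φ x * l x + q x * q x) (hx : x ∈ D) (v : ℝ × ℝ) :
    2 * (p x * fderiv ℝ p x v) =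
      2 * (φ x * (fderiv ℝ F x v * l x)) + φ x * fderiv ℝ l x v
        + 2 * (q x * fderiv ℝ q x v) := by
  have := HasPD.eq_of_eqOn hD hx hdet (.mul (hp.hasPD hD hx v) (hp.hasPD hD hx v))
    (.add (.mul (hφ x hx v) (hl.hasPD hD hx v)) (.mul (hq.hasPD hD hx v) (hq.hasPD hD hx v)))
  linear_combination this

theorem fderiv_mul_add_sq (hD : IsOpen D) (hq : ContDiffOn ℝ ∞ q D) (hl : ContDiffOn ℝ ∞ l D)
    (hp : ContDiffOn ℝ ∞ p D) (hA : ContDiffOn ℝ ∞ A D)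
    (hφ : ∀ x ∈ D, ∀ v, HasPD v φ (2 * φ x * fderiv ℝ F x v) x)
    (hqA : ∀ x ∈ D, q x = 0 - A x * φ x)
    (hdet : ∀ x ∈ D, p x * p x = φ x * l x + q x * q x) (hx : x ∈ D) (v : ℝ × ℝ) :
    fderiv ℝ φ x v * fderiv ℝ l x v + fderiv ℝ q x v ^ 2 =
      4 * p x * fderiv ℝ p x v * fderiv ℝ F x v - 4 * p x ^ 2 * fderiv ℝ F x v ^ 2
        + φ x ^ 2 * fderiv ℝ A x v ^ 2 := by
  have h1 := fderiv_det hD hq hl hp hφ hdet hx v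
  have h2 := fderiv_twist hD hq hA hφ hqA hx v
  have h3 := hdet x hx
  rw [(hφ x hx v).2]
  rw [h2, hqA x hx] at h1
  rw [hqA x hx] at h3
  rw [h2]
  linear_combination (-2) * fderiv ℝ F x v * h1 + 4 * fderiv ℝ F x v ^ 2 * h3

theorem reduced_field_equations (hD : IsOpen D) (hq : ContDiffOn ℝ ∞ q D)
    (hl : ContDiffOn ℝ ∞ l D) (hp : ContDiffOn ℝ ∞ p D) (hF : ContDiffOn ℝ ∞ F D)
    (hA : ContDiffOn ℝ ∞ A D)
    (hφ : ∀ x ∈ D, ∀ v, HasPD v φ (2 * φ x * fderiv ℝ F x v) x)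
    (hqA : ∀ x ∈ D, q x = 0 - A x * φ x)
    (hdet : ∀ x ∈ D, p x * p x = φ x * l x + q x * q x) (hx : x ∈ D)
    (hφ0 : φ x ≠ 0) (hp0 : p x ≠ 0) {κ e r P : ℝ}
    (h00 : ricciBracket p (SigF φ q l x) φ x = κ * p x ^ 2 * e * (r + 2 * P) * φ x)
    (h02 : ricciBracket p (SigF φ q l x) q x = κ * p x ^ 2 * e * (r + 2 * P) * q x)
    (h22 : φ x * ricciBracket p (SigF φ q l x) l x =
      -(κ * p x ^ 2 * e * (r * (p x ^ 2 + q x ^ 2) - 2 * P * (l x * φ x)))) :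
    (2 * p x ^ 2 * (pd1 (pd1 F) x + pd3 (pd3 F) x)
      + 2 * p x * (pd1 F x * pd1 p x + pd3 F x * pd3 p x)
      + φ x ^ 2 * (pd1 A x ^ 2 + pd3 A x ^ 2) = κ * p x ^ 2 * e * (r + 2 * P)) ∧
    (p x * (pd1 (pd1 A) x + pd3 (pd3 A) x)
      + 4 * p x * (pd1 A x * pd1 F x + pd3 A x * pd3 F x)
      - (pd1 A x * pd1 p x + pd3 A x * pd3 p x) = 0) ∧
    pd1 (pd1 p) x + pd3 (pd3 p) x = 2 * κ * (e * (P * p x)) := by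
  have d1φ (v : ℝ × ℝ) : fderiv ℝ φ x v = 2 * φ x * fderiv ℝ F x v := (hφ x hx v).2
  have d2φ (v : ℝ × ℝ) : fderiv ℝ (fun y => fderiv ℝ φ y v) x v =
      2 * φ x * (2 * fderiv ℝ F x v ^ 2 + fderiv ℝ (fun y => fderiv ℝ F y v) x v) := by
    have h := HasPD.mul (.mul (.const 2) (hφ x hx v))
      ((hF.fderiv_apply_const hD v).hasPD hD hx v)
    have heq : Set.EqOn (fun y => fderiv ℝ φ y v) (fun y => 2 * φ y * fderiv ℝ F y v) D :=
      fun y hy => (hφ y hy v).2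
    rw [(heq.eventuallyEq_of_mem (hD.mem_nhds hx)).fderiv_eq, h.2]
    ring
  have d1q (v : ℝ × ℝ) := fderiv_twist hD hq hA hφ hqA hx v
  have d2q (v : ℝ × ℝ) := HasPD.eq_of_eqOn hD hx
    (fun y hy => fderiv_twist hD hq hA hφ hqA hy v)
    ((hq.fderiv_apply_const hD v).hasPD hD hx v)
    (.sub (.const 0) (.mul (hφ x hx v) (.add ((hA.fderiv_apply_const hD v).hasPD hD hx v)
      (.mul (.const 2) (.mul (hA.hasPD hD hx v) ((hF.fderiv_apply_const hD v).hasPD hD hx v))))))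
  have d1p (v : ℝ × ℝ) := fderiv_det hD hq hl hp hφ hdet hx v
  have d2p (v : ℝ × ℝ) := HasPD.eq_of_eqOn hD hx
    (fun y hy => fderiv_det hD hq hl hp hφ hdet hy v)
    (.mul (.const 2) (.mul (hp.hasPD hD hx v) ((hp.fderiv_apply_const hD v).hasPD hD hx v)))
    (.add (.add
      (.mul (.const 2) (.mul (hφ x hx v)
        (.mul ((hF.fderiv_apply_const hD v).hasPD hD hx v) (hl.hasPD hD hx v))))
      (.mul (hφ x hx v) ((hl.fderiv_apply_const hD v).hasPD hD hx v)))
      (.mul (.const 2) (.mul (hq.hasPD hD hx v) ((hq.fderiv_apply_const hD v).hasPD hD hx v))))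
  have sq (v : ℝ × ℝ) := fderiv_mul_add_sq hD hq hl hp hA hφ hqA hdet hx v
  have hq0 := hqA x hx
  have hdet0 := hdet x hx
  have φ1 : pd1 φ x = _ := d1φ (1, 0)
  have φ3 : pd3 φ x = _ := d1φ (0, 1)
  have φ11 : pd1 (pd1 φ) x = _ := d2φ (1, 0)
  have φ33 : pd3 (pd3 φ) x = _ := d2φ (0, 1)
  have q1 : pd1 q x = _ := d1q (1, 0)
  have q3 : pd3 q x = _ := d1q (0, 1)
  have q11 : pd1 (pd1 q) x = _ := d2q (1, 0)
  have q33 : pd3 (pd3 q) x = _ := d2q (0, 1)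
  have p1 := d1p (1, 0)
  have p3 := d1p (0, 1)
  have p11 := d2p (1, 0)
  have p33 := d2p (0, 1)
  have s1 := sq (1, 0)
  have s3 := sq (0, 1)
  have fold1 (u : ℝ × ℝ → ℝ) (y : ℝ × ℝ) : fderiv ℝ u y (1, 0) = pd1 u y := rfl
  have fold3 (u : ℝ × ℝ → ℝ) (y : ℝ × ℝ) : fderiv ℝ u y (0, 1) = pd3 u y := rfl
  have foldf1 (u : ℝ × ℝ → ℝ) : (fun y => pd1 u y) = pd1 u := rfl
  have foldf3 (u : ℝ × ℝ → ℝ) : (fun y => pd3 u y) = pd3 u := rfl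
  simp only [fold1, fold3, foldf1, foldf3] at φ1 φ3 φ11 φ33 q1 q3 q11 q33 p1 p3 p11 p33 s1 s3
  have hS : SigF φ q l x = 4 * p x * (pd1 p x * pd1 F x + pd3 p x * pd3 F x)
      - 4 * p x ^ 2 * (pd1 F x ^ 2 + pd3 F x ^ 2) + φ x ^ 2 * (pd1 A x ^ 2 + pd3 A x ^ 2) := by
    rw [SigF]
    linear_combination s1 + s3
  have hS' : SigF φ q l x = pd1 φ x * pd1 l x + pd3 φ x * pd3 l x + pd1 q x ^ 2 + pd3 q x ^ 2 :=
    rfl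
  refine ⟨?_, ?_, ?_⟩
  · rw [ricciBracket, hS, φ1, φ3, φ11, φ33] at h00
    apply mul_left_cancel₀ hφ0
    linear_combination h00
  · rw [ricciBracket, hS, φ1, φ3, φ11, φ33] at h00
    rw [ricciBracket, hS, q1, q3, q11, q33, hq0] at h02
    apply mul_left_cancel₀ (mul_ne_zero hφ0 hp0)
    linear_combination -h02 - A x * h00
  · have h : l x * ricciBracket p (SigF φ q l x) φ x + φ x * ricciBracket p (SigF φ q l x) l x
        + 2 * q x * ricciBracket p (SigF φ q l x) q x
        = 2 * p x ^ 3 * (pd1 (pd1 p) x + pd3 (pd3 p) x) := by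
      simp only [ricciBracket]
      rw [φ1, φ3] at hS'
      rw [φ1, φ3, φ11, φ33]
      linear_combination (-p x ^ 2) * (p11 + p33) + p x * pd1 p x * p1 + p x * pd3 p x * p3
        + 2 * p x ^ 2 * hS' - 2 * SigF φ q l x * hdet0
    rw [h00, h02, h22] at h
    apply mul_left_cancel₀ (pow_ne_zero 3 hp0)
    linear_combination (-1 / 2) * h - κ * p x ^ 2 * e * (r + 4 * P) / 2 * hdet0

end Potentials

/-- Proposition D: under (B2), the (00), (02), (22) Einstein equations, the Euler
relations, and the first-order equations (ECd), (ECe), the remaining Einstein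
equations R₁₁ = (8πG/c⁴)𝔗₁₁ and R₃₃ = (8πG/c⁴)𝔗₃₃ hold. -/
theorem first_order_Kprime_imp_einstein
    (D : Set (ℝ × ℝ)) (hD : IsOpen D) (hDconn : IsConnected D)
    (Ω c G : ℝ) (hc : 0 < c) (hG : 0 < G)
    (f k l m ρ P : ℝ × ℝ → ℝ)
    (hf : ContDiffOn ℝ (⊤ : ℕ∞) f D) (hk : ContDiffOn ℝ (⊤ : ℕ∞) k D) (hl : ContDiffOn ℝ (⊤ : ℕ∞) l D)
    (hm : ContDiffOn ℝ (⊤ : ℕ∞) m D) (hρ : ContDiffOn ℝ (⊤ : ℕ∞) ρ D) (hP : ContDiffOn ℝ (⊤ : ℕ∞) P D)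
    (hpos : ∀ x ∈ D, 0 < f x * l x + (k x) ^ 2)
    (hfP : ∀ x ∈ D, 0 < fP Ω c f k l x)
    (hB2 : ∀ x ∈ D, 0 < (pd1 (PiF f k l) x) ^ 2 + (pd3 (PiF f k l) x) ^ 2)
    (hE00 : ∀ x ∈ D, R00 f k l m x = (8 * π * G / c ^ 4) * T00 Ω c f k l ρ P x)
    (hE02 : ∀ x ∈ D, R02 f k l m x = (8 * π * G / c ^ 4) * T02 Ω c f k l ρ P x)
    (hE22 : ∀ x ∈ D, R22 f k l m x = (8 * π * G / c ^ 4) * T22 Ω c f k l ρ P x)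
    (hEuler1 : ∀ x ∈ D, pd1 P x + (c ^ 2 * ρ x + P x) * pd1 (FP Ω c f k l) x = 0)
    (hEuler3 : ∀ x ∈ D, pd3 P x + (c ^ 2 * ρ x + P x) * pd3 (FP Ω c f k l) x = 0)
    (hECd : ∀ x ∈ D, ECd Ω c f k l m x)
    (hECe : ∀ x ∈ D, ECe Ω c f k l m x) :
    ∀ x ∈ D,
      R11 f k l m x = (8 * π * G / c ^ 4) * ((Real.exp (m x) / 2) * (c ^ 2 * ρ x - P x)) ∧
      R33 f k l m x = (8 * π * G / c ^ 4) * ((Real.exp (m x) / 2) * (c ^ 2 * ρ x - P x)) := by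
  have hdet0 : ContDiffOn ℝ ∞ (fun y => f y * l y + k y ^ 2) D := (hf.mul hl).add (hk.pow 2)
  have hp : ContDiffOn ℝ ∞ (PiF f k l) D := hdet0.sqrt fun y hy => (hpos y hy).ne'
  have hφ : ContDiffOn ℝ ∞ (fP Ω c f k l) D :=
    (hf.sub (contDiffOn_const.mul hk)).sub (contDiffOn_const.mul hl)
  have hq : ContDiffOn ℝ ∞ (kP Ω c k l) D := hk.add (contDiffOn_const.mul hl)
  have hF : ContDiffOn ℝ ∞ (FP Ω c f k l) D :=
    contDiffOn_const.mul (hφ.log fun y hy => (hfP y hy).ne')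
  have hA : ContDiffOn ℝ ∞ (AP Ω c f k l) D := hq.neg.div hφ fun y hy => (hfP y hy).ne'
  have hK : ContDiffOn ℝ ∞ (KP Ω c f k l m) D := hF.add (hm.div_const 2)
  have hp0 (y) (hy : y ∈ D) : PiF f k l y ≠ 0 := (Real.sqrt_pos.2 (hpos y hy)).ne'
  have hpsq (y) (hy : y ∈ D) : PiF f k l y ^ 2 = f y * l y + k y ^ 2 :=
    Real.sq_sqrt (hpos y hy).le
  have hφF (y) (hy : y ∈ D) (v : ℝ × ℝ) :
      HasPD v (fP Ω c f k l) (2 * fP Ω c f k l y * fderiv ℝ (FP Ω c f k l) y v) y := by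
    have h0 := (hfP y hy).ne'
    have h := (HasPD.mul (.const (1 / 2))
      (HasPD.comp (Real.hasDerivAt_log h0) (hφ.hasPD hD hy v))).2
    change fderiv ℝ (FP Ω c f k l) y v = _ at h
    refine (hφ.hasPD hD hy v).congr_deriv ?_
    rw [h]
    field_simp
    ring
  have hqA (y) (hy : y ∈ D) :
      kP Ω c k l y = 0 - AP Ω c f k l y * fP Ω c f k l y := by
    have h0 := (hfP y hy).ne'
    rw [AP]
    field_simp
    ring
  have hdet (y) (hy : y ∈ D) : PiF f k l y * PiF f k l y =
      fP Ω c f k l y * l y + kP Ω c k l y * kP Ω c k l y := by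
    rw [← sq, hpsq y hy, fP, kP]
    ring
  have hexp4 (y) (hy : y ∈ D) :
      Real.exp (4 * FP Ω c f k l y) = fP Ω c f k l y * fP Ω c f k l y := by
    rw [FP, show 4 * (1 / 2 * Real.log (fP Ω c f k l y)) =
      Real.log (fP Ω c f k l y) + Real.log (fP Ω c f k l y) by ring, Real.exp_add,
      Real.exp_log (hfP y hy)]
  have hmK (y) (hy : y ∈ D) : m y = 2 * KP Ω c f k l m y - 2 * FP Ω c f k l y := by
    rw [KP]
    ring
  have hdm (y) (hy : y ∈ D) (v : ℝ × ℝ) : fderiv ℝ m y v =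
      2 * fderiv ℝ (KP Ω c f k l m) y v - 2 * fderiv ℝ (FP Ω c f k l) y v := by
    have := HasPD.eq_of_eqOn hD hy hmK (hm.hasPD hD hy v)
      (.sub (.mul (.const 2) (hK.hasPD hD hy v)) (.mul (.const 2) (hF.hasPD hD hy v)))
    linear_combination this
  have hE (y) (hy : y ∈ D) (v : ℝ × ℝ) : HasPD v (fun z => Real.exp (m z))
      (Real.exp (m y) * (2 * fderiv ℝ (KP Ω c f k l m) y v
        - 2 * fderiv ℝ (FP Ω c f k l) y v)) y :=
    (HasPD.comp (Real.hasDerivAt_exp (m y)) (hm.hasPD hD hy v)).congr_deriv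
      (by rw [hdm y hy v])
  have hφd (y) (hy : y ∈ D) (v : ℝ × ℝ) : fderiv ℝ (fP Ω c f k l) y v =
      fderiv ℝ f y v - 2 * (Ω / c) * fderiv ℝ k y v - Ω ^ 2 / c ^ 2 * fderiv ℝ l y v := by
    have := (((hf.hasPD hD hy v).sub (.mul (.const (2 * (Ω / c))) (hk.hasPD hD hy v))).sub
      (.mul (.const (Ω ^ 2 / c ^ 2)) (hl.hasPD hD hy v))).2
    change fderiv ℝ (fP Ω c f k l) y v = _ at this
    linear_combination this
  have hqd (y) (hy : y ∈ D) (v : ℝ × ℝ) : fderiv ℝ (kP Ω c k l) y v =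
      fderiv ℝ k y v + Ω / c * fderiv ℝ l y v := by
    have := ((hk.hasPD hD hy v).add (.mul (.const (Ω / c)) (hl.hasPD hD hy v))).2
    change fderiv ℝ (kP Ω c k l) y v = _ at this
    linear_combination this
  have hquad (y) (hy : y ∈ D) (v : ℝ × ℝ) :
      fderiv ℝ f y v * fderiv ℝ l y v + fderiv ℝ k y v ^ 2 =
      fderiv ℝ (fP Ω c f k l) y v * fderiv ℝ l y v + fderiv ℝ (kP Ω c k l) y v ^ 2 := by
    rw [hφd y hy, hqd y hy]
    ring
  have hSig (y) (hy : y ∈ D) : SigF f k l y = SigF (fP Ω c f k l) (kP Ω c k l) l y := by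
    have h1 := hquad y hy (1, 0)
    have h3 := hquad y hy (0, 1)
    simp only [SigF, pd1, pd3]
    linear_combination h1 + h3
  have hfield (y) (hy : y ∈ D) := by
    have h0 := (hfP y hy).ne'
    have hb {u : ℝ × ℝ → ℝ} (hu : ContDiffOn ℝ ∞ u D) :=
      bracket_eq_ricciBracket_div hD hy hp (hp0 y hy) (SigF f k l y) hu
    have h00 := hE00 y hy
    have h02 := hE02 y hy
    have h22 := hE22 y hy
    rw [R00, hb hf] at h00
    rw [R02, hb hk, neg_eq_iff_eq_neg, ← mul_neg] at h02
    rw [R22, hb hl, neg_eq_iff_eq_neg, ← mul_neg] at h22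
    have r00 := ricciBracket_of_component (hp0 y hy) rfl h00 rfl
    have r02 := ricciBracket_of_component (hp0 y hy) rfl h02 rfl
    have r22 := ricciBracket_of_component (hp0 y hy) rfl h22 rfl
    have hfk : ContDiffOn ℝ ∞ (fun z => f z + -(2 * (Ω / c)) * k z) D :=
      hf.add (contDiffOn_const.mul hk)
    have rφ := ricciBracket_add_const_mul (p := PiF f k l) hD hy (SigF f k l y)
      (-(Ω ^ 2 / c ^ 2)) hfk hl hφ (fun z _ => by rw [fP]; ring)
    rw [ricciBracket_add_const_mul hD hy (SigF f k l y) (-(2 * (Ω / c))) hf hk hfk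
      (fun _ _ => rfl), r00, r02, r22] at rφ
    have rq := ricciBracket_add_const_mul (p := PiF f k l) hD hy (SigF f k l y)
      (Ω / c) hk hl hq (fun _ _ => rfl)
    rw [r02, r22] at rq
    rw [hSig y hy] at rφ rq r22
    have hff : f y = fP Ω c f k l y + 2 * (Ω / c) * k y + Ω ^ 2 / c ^ 2 * l y := by
      rw [fP]
      ring
    have hkk : k y = kP Ω c k l y - Ω / c * l y := by
      rw [kP]
      ring
    have hd := hdet y hy
    refine reduced_field_equations hD hq hl hp hF hA hφF hqA hdet hy h0 (hp0 y hy)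
      (κ := 8 * π * G / c ^ 4) (e := Real.exp (m y)) (r := c ^ 2 * ρ y + P y) (P := P y)
      ?_ ?_ ?_
    · rw [rφ, T00, T02, T22, hff, hkk]
      generalize fP Ω c f k l y = φ at *
      generalize kP Ω c k l y = q at *
      generalize PiF f k l y = p at *
      rw [show p ^ 2 = φ * l y + q * q by rw [sq, hd]]
      generalize 8 * π * G / c ^ 4 = κ at *
      rw [← div_pow]
      generalize Ω / c = w at *
      field_simp
      ring
    · rw [rq, T02, T22, hff, hkk]
      generalize fP Ω c f k l y = φ at *
      generalize kP Ω c k l y = q at *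
      generalize PiF f k l y = p at *
      rw [show p ^ 2 = φ * l y + q * q by rw [sq, hd]]
      generalize 8 * π * G / c ^ 4 = κ at *
      rw [← div_pow]
      generalize Ω / c = w at *
      field_simp
      ring
    · rw [r22, T22, show k y + Ω / c * l y = kP Ω c k l y from rfl]
      generalize fP Ω c f k l y = φ at *
      generalize 8 * π * G / c ^ 4 = κ at *
      field_simp
  have hd (y) (hy : y ∈ D) :
      4 * (PiF f k l y * (pd1 (PiF f k l) y * pd1 (KP Ω c f k l m) y
        - pd3 (PiF f k l) y * pd3 (KP Ω c f k l m) y)) =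
      2 * (PiF f k l y * (pd1 (pd1 (PiF f k l)) y - pd3 (pd3 (PiF f k l)) y))
      + 4 * ((PiF f k l y * PiF f k l y) * (pd1 (FP Ω c f k l) y * pd1 (FP Ω c f k l) y
        - pd3 (FP Ω c f k l) y * pd3 (FP Ω c f k l) y))
      - (fP Ω c f k l y * fP Ω c f k l y) * (pd1 (AP Ω c f k l) y * pd1 (AP Ω c f k l) y
        - pd3 (AP Ω c f k l) y * pd3 (AP Ω c f k l) y) := by
    have h := hECd y hy
    have := hp0 y hy
    rw [ECd, hexp4 y hy] at h
    rw [h]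
    field_simp
    ring
  have he (y) (hy : y ∈ D) :
      2 * (PiF f k l y * (pd3 (PiF f k l) y * pd1 (KP Ω c f k l m) y
        + pd1 (PiF f k l) y * pd3 (KP Ω c f k l m) y)) =
      2 * (PiF f k l y * pd1 (pd3 (PiF f k l)) y)
      + 4 * ((PiF f k l y * PiF f k l y) * (pd1 (FP Ω c f k l) y * pd3 (FP Ω c f k l) y))
      - (fP Ω c f k l y * fP Ω c f k l y)
        * (pd1 (AP Ω c f k l) y * pd3 (AP Ω c f k l) y) := by
    have h := hECe y hy
    have := hp0 y hy
    rw [ECe, hexp4 y hy] at h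
    rw [h]
    field_simp
    ring
  have hlap := laplacian_of_first_order hD (κ := 8 * π * G / c ^ 4)
    (ρ := fun y => c ^ 2 * ρ y + P y) (E := fun y => Real.exp (m y)) hp hF hA hK hP hφF hE hB2
    hEuler1 hEuler3 (fun y hy => (hfield y hy).1) (fun y hy => (hfield y hy).2.1)
    (fun y hy => (hfield y hy).2.2) hd he
  intro x hx
  have h0 := hp0 x hx
  have hm1 : pd1 m x = 2 * pd1 (KP Ω c f k l m) x - 2 * pd1 (FP Ω c f k l) x := hdm x hx _
  have hm3 : pd3 m x = 2 * pd3 (KP Ω c f k l m) x - 2 * pd3 (FP Ω c f k l) x := hdm x hx _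
  have hd2m (v : ℝ × ℝ) := HasPD.eq_of_eqOn hD hx (fun y hy => hdm y hy v)
    ((hm.fderiv_apply_const hD v).hasPD hD hx v)
    (.sub (.mul (.const 2) ((hK.fderiv_apply_const hD v).hasPD hD hx v))
      (.mul (.const 2) ((hF.fderiv_apply_const hD v).hasPD hD hx v)))
  have hm11 : pd1 (pd1 m) x = 2 * pd1 (pd1 (KP Ω c f k l m)) x
      - 2 * pd1 (pd1 (FP Ω c f k l)) x := by
    have h := hd2m (1, 0)
    change pd1 (pd1 m) x = 0 * pd1 (KP Ω c f k l m) x + 2 * pd1 (pd1 (KP Ω c f k l m)) x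
      - (0 * pd1 (FP Ω c f k l) x + 2 * pd1 (pd1 (FP Ω c f k l)) x) at h
    linear_combination h
  have hm33 : pd3 (pd3 m) x = 2 * pd3 (pd3 (KP Ω c f k l m)) x
      - 2 * pd3 (pd3 (FP Ω c f k l)) x := by
    have h := hd2m (0, 1)
    change pd3 (pd3 m) x = 0 * pd3 (KP Ω c f k l m) x + 2 * pd3 (pd3 (KP Ω c f k l m)) x
      - (0 * pd3 (FP Ω c f k l) x + 2 * pd3 (pd3 (FP Ω c f k l)) x) at h
    linear_combination h
  have hquad1 : pd1 f x * pd1 l x + pd1 k x ^ 2 = _ :=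
    (hquad x hx (1, 0)).trans (fderiv_mul_add_sq hD hq hl hp hA hφF hqA hdet hx (1, 0))
  have hquad3 : pd3 f x * pd3 l x + pd3 k x ^ 2 = _ :=
    (hquad x hx (0, 1)).trans (fderiv_mul_add_sq hD hq hl hp hA hφF hqA hdet hx (0, 1))
  change _ = 4 * PiF f k l x * pd1 (PiF f k l) x * pd1 (FP Ω c f k l) x
    - 4 * PiF f k l x ^ 2 * pd1 (FP Ω c f k l) x ^ 2
    + fP Ω c f k l x ^ 2 * pd1 (AP Ω c f k l) x ^ 2 at hquad1
  change _ = 4 * PiF f k l x * pd3 (PiF f k l) x * pd3 (FP Ω c f k l) x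
    - 4 * PiF f k l x ^ 2 * pd3 (FP Ω c f k l) x ^ 2
    + fP Ω c f k l x ^ 2 * pd3 (AP Ω c f k l) x ^ 2 at hquad3
  obtain ⟨hFeq, -, hpeq⟩ := hfield x hx
  have hKeq := hlap x hx
  have hdx := hd x hx
  rw [R11, R33, hquad1, hquad3, hm1, hm3, hm11, hm33]
  generalize 8 * π * G / c ^ 4 = κ at *
  have hsq : PiF f k l x ^ 2 ≠ 0 := pow_ne_zero 2 h0
  constructor
  · apply mul_left_cancel₀ hsq
    field_simp
    linear_combination hdx / 2 - hKeq / 2 + hFeq - PiF f k l x * hpeq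
  · apply mul_left_cancel₀ hsq
    field_simp
    linear_combination -hdx / 2 - hKeq / 2 + hFeq - PiF f k l x * hpeq
end

section
/- The identity (e^m/Π)·(l·R₀₀ − 2k·R₀₂ − f·R₂₂) = ∂₁²Π + ∂₃²Π holds on D. -/
open Real

section DirectionalDerivative

variable {f k l : ℝ × ℝ → ℝ} {x : ℝ × ℝ}

lemma differentiableAt_fderiv_apply {g : ℝ × ℝ → ℝ} (hg : ContDiffAt ℝ 2 g x) (v : ℝ × ℝ) :
    DifferentiableAt ℝ (fun y => fderiv ℝ g y v) x :=
  ((hg.fderiv_right (m := 1) (by norm_num)).differentiableAt one_ne_zero).clm_apply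
    (differentiableAt_const v)

lemma fderiv_PiF_apply (hf : DifferentiableAt ℝ f x) (hk : DifferentiableAt ℝ k x)
    (hl : DifferentiableAt ℝ l x) (hpos : 0 < f x * l x + k x ^ 2) (v : ℝ × ℝ) :
    2 * fderiv ℝ (PiF f k l) x v
      = l x * (fderiv ℝ f x v / PiF f k l x) + 2 * (k x * (fderiv ℝ k x v / PiF f k l x))
        + f x * (fderiv ℝ l x v / PiF f k l x) := by
  have h := (((hf.hasFDerivAt.mul hl.hasFDerivAt).add (hk.hasFDerivAt.pow 2)).sqrt hpos.ne')
  have h' : fderiv ℝ (PiF f k l) x = _ := h.fderiv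
  have hne : PiF f k l x ≠ 0 := (Real.sqrt_pos.2 hpos).ne'
  rw [h']
  change 2 * ((1 / (2 * PiF f k l x)) • _ : ℝ × ℝ →L[ℝ] ℝ) v = _
  simp only [FunLike.coe_add, FunLike.coe_smul, Pi.add_apply, Pi.smul_apply, smul_eq_mul,
    nsmul_eq_mul]
  field_simp
  push_cast
  ring

/-- The second derivative of `Π` along `v`, obtained by differentiating `fderiv_PiF_apply`. -/
lemma fderiv_fderiv_PiF_apply (hf : ContDiffAt ℝ 2 f x) (hk : ContDiffAt ℝ 2 k x)
    (hl : ContDiffAt ℝ 2 l x) (hpos : 0 < f x * l x + k x ^ 2) (v : ℝ × ℝ) :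
    2 * fderiv ℝ (fun y => fderiv ℝ (PiF f k l) y v) x v
      = l x * fderiv ℝ (fun y => fderiv ℝ f y v / PiF f k l y) x v
        + 2 * (k x * fderiv ℝ (fun y => fderiv ℝ k y v / PiF f k l y) x v)
        + f x * fderiv ℝ (fun y => fderiv ℝ l y v / PiF f k l y) x v
        + 2 * (fderiv ℝ f x v * fderiv ℝ l x v + fderiv ℝ k x v ^ 2) / PiF f k l x := by
  have hne : PiF f k l x ≠ 0 := (Real.sqrt_pos.2 hpos).ne'
  have hP : ContDiffAt ℝ 2 (PiF f k l) x := ((hf.mul hl).add (hk.pow 2)).sqrt hpos.ne'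
  have hev : (fun y => 2 * fderiv ℝ (PiF f k l) y v) =ᶠ[nhds x] fun y =>
      l y * (fderiv ℝ f y v / PiF f k l y) + 2 * (k y * (fderiv ℝ k y v / PiF f k l y))
        + f y * (fderiv ℝ l y v / PiF f k l y) := by
    have hc : ContinuousAt (fun y => f y * l y + k y ^ 2) x :=
      (hf.continuousAt.mul hl.continuousAt).add (hk.continuousAt.pow 2)
    filter_upwards [hf.eventually (by simp), hk.eventually (by simp), hl.eventually (by simp),
      hc.eventually (lt_mem_nhds hpos)] with y hfy hky hly hy
    exact fderiv_PiF_apply (hfy.differentiableAt two_ne_zero) (hky.differentiableAt two_ne_zero)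
      (hly.differentiableAt two_ne_zero) hy v
  have hquot {g : ℝ × ℝ → ℝ} (hg : ContDiffAt ℝ 2 g x) :
      HasFDerivAt (fun y => fderiv ℝ g y v / PiF f k l y)
        (fderiv ℝ (fun y => fderiv ℝ g y v / PiF f k l y) x) x := by
    refine DifferentiableAt.hasFDerivAt ?_
    simp only [div_eq_mul_inv]
    exact (differentiableAt_fderiv_apply hg v).mul ((hP.differentiableAt two_ne_zero).inv hne)
  have hasD {g : ℝ × ℝ → ℝ} (hg : ContDiffAt ℝ 2 g x) : HasFDerivAt g (fderiv ℝ g x) x :=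
    (hg.differentiableAt two_ne_zero).hasFDerivAt
  have hR := (((hasD hl).mul (hquot hf)).add (((hasD hk).mul (hquot hk)).const_mul 2)).add
    ((hasD hf).mul (hquot hl))
  have hL := (differentiableAt_fderiv_apply hP v).hasFDerivAt.const_mul 2
  have h := congrArg (fun T : ℝ × ℝ →L[ℝ] ℝ => T v) (hL.unique (hR.congr_of_eventuallyEq hev))
  simp only [FunLike.coe_add, FunLike.coe_smul, Pi.add_apply, Pi.smul_apply, smul_eq_mul] at h
  rw [h]
  ring

end DirectionalDerivative

/-- Identity (32): (e^m/Π)(l·R₀₀ − 2k·R₀₂ − f·R₂₂) = ∂₁²Π + ∂₃²Π. -/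
theorem Ricci_combination_eq_laplacian_Pi
    (D : Set (ℝ × ℝ)) (hD : IsOpen D) (hDconn : IsConnected D)
    (f k l m : ℝ × ℝ → ℝ)
    (hf : ContDiffOn ℝ (⊤ : ℕ∞) f D) (hk : ContDiffOn ℝ (⊤ : ℕ∞) k D) (hl : ContDiffOn ℝ (⊤ : ℕ∞) l D)
    (hm : ContDiffOn ℝ (⊤ : ℕ∞) m D)
    (hpos : ∀ x ∈ D, 0 < f x * l x + (k x) ^ 2) :
    ∀ x ∈ D,
      (Real.exp (m x) / PiF f k l x) *
          (l x * R00 f k l m x - 2 * k x * R02 f k l m x - f x * R22 f k l m x)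
        = pd1 (pd1 (PiF f k l)) x + pd3 (pd3 (PiF f k l)) x := by
  intro x hx
  have smooth {g : ℝ × ℝ → ℝ} (hg : ContDiffOn ℝ (⊤ : ℕ∞) g D) : ContDiffAt ℝ 2 g x :=
    (hg.contDiffAt (hD.mem_nhds hx)).of_le (WithTop.coe_le_coe.2 (le_top : (2 : ℕ∞) ≤ ⊤))
  have h1 := fderiv_fderiv_PiF_apply (smooth hf) (smooth hk) (smooth hl) (hpos x hx) (1, 0)
  have h3 := fderiv_fderiv_PiF_apply (smooth hf) (smooth hk) (smooth hl) (hpos x hx) (0, 1)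
  have hne : PiF f k l x ≠ 0 := (Real.sqrt_pos.2 (hpos x hx)).ne'
  have hsq : f x * l x + k x ^ 2 = PiF f k l x ^ 2 := (Real.sq_sqrt (hpos x hx).le).symm
  have hcoef : l x * R00 f k l m x - 2 * k x * R02 f k l m x - f x * R22 f k l m x
      = PiF f k l x * Real.exp (-(m x)) * (pd1 (pd1 (PiF f k l)) x + pd3 (pd3 (PiF f k l)) x) := by
    have hS : (f x * l x + k x ^ 2) * (SigF f k l x / PiF f k l x ^ 3)
        = SigF f k l x / PiF f k l x := by
      rw [hsq]
      field_simp
    unfold SigF pd1 pd3 at hS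
    unfold R00 R02 R22 SigF pd1 pd3
    linear_combination PiF f k l x * Real.exp (-(m x)) * (hS - h1 / 2 - h3 / 2)
  rw [hcoef, Real.exp_neg]
  field_simp
end

section
/- The identity 𝔗₀₀ + 2(Ω/c)·𝔗₀₂ + (Ω²/c²)·𝔗₂₂ = ½·(c²ρ + 3P)·f' holds. -/
/-- Equation (46): 𝔗₀₀ + 2(Ω/c)·𝔗₀₂ + (Ω²/c²)·𝔗₂₂ = ½(c²ρ + 3P)·f',
where Π² = f·l + k² and f' = f − 2(Ω/c)k − (Ω²/c²)l. -/
theorem Tfrak_combination_eq_enthalpy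
    (Ω c f k l ρ P : ℝ) (hc : 0 < c)
    (hpos : 0 < f * l + k ^ 2)
    (hf' : 0 < f - 2 * (Ω / c) * k - (Ω ^ 2 / c ^ 2) * l) :
    ((1 / 2) * (c ^ 2 * ρ + P) * (1 / (f - 2 * (Ω / c) * k - (Ω ^ 2 / c ^ 2) * l)) *
          ((f - (Ω / c) * k) ^ 2 + (Ω ^ 2 / c ^ 2) * (f * l + k ^ 2)) + P * f)
      + 2 * (Ω / c) *
        ((1 / 2) * (c ^ 2 * ρ + P) * (1 / (f - 2 * (Ω / c) * k - (Ω ^ 2 / c ^ 2) * l)) *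
          (-(k * f) - 2 * (Ω / c) * f * l + (Ω ^ 2 / c ^ 2) * k * l) - P * k)
      + (Ω ^ 2 / c ^ 2) *
        ((1 / 2) * (c ^ 2 * ρ + P) * (1 / (f - 2 * (Ω / c) * k - (Ω ^ 2 / c ^ 2) * l)) *
          ((f * l + k ^ 2) + (k + (Ω / c) * l) ^ 2) - P * l)
      = (1 / 2) * (c ^ 2 * ρ + 3 * P) * (f - 2 * (Ω / c) * k - (Ω ^ 2 / c ^ 2) * l) := by
  rw [← div_pow] at hf' ⊢
  generalize Ω / c = w at hf' ⊢
  have hne := hf'.ne'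
  generalize hF : f - 2 * w * k - w ^ 2 * l = F at hne ⊢
  have hinv : 1 / F * F ^ 2 = F := by field_simp
  have hsq : ((f - w * k) ^ 2 + w ^ 2 * (f * l + k ^ 2))
      + 2 * w * (-(k * f) - 2 * w * f * l + w ^ 2 * k * l)
      + w ^ 2 * ((f * l + k ^ 2) + (k + w * l) ^ 2) = F ^ 2 := by
    rw [← hF]
    ring
  linear_combination (1 / 2) * (c ^ 2 * ρ + P) * (1 / F) * hsq
    + (1 / 2) * (c ^ 2 * ρ + P) * hinv + P * hF
end
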